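/- Let n ≥ 1, let Ω ⊂ ℝ^n be open, and let f ∈ L^1_loc(Ω). Then (1/2)·|D^j f|(Ω) ≤ liminf_{ε→0} κ_ε(f, Ω). -/

import Mathlib

open MeasureTheory Filter Topology Metric
open scoped ENNReal RealInnerProductSpace Classical

noncomputable section

/-- An open cube in `ℝⁿ` with side length `ε` and arbitrary orientation. -/
def IsCube (n : ℕ) (ε : ℝ) (Q : Set (EuclideanSpace ℝ (Fin n))) : Prop :=
  ∃ (T : EuclideanSpace ℝ (Fin n) ≃ₗᵢ[ℝ] EuclideanSpace ℝ (Fin n))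
    (x : EuclideanSpace ℝ (Fin n)),
    Q = (fun y => x + T y) '' {y : EuclideanSpace ℝ (Fin n) | ∀ i, |y i| < ε / 2}

/-- The BMO-type functional `κ_ε(f, Ω)`. -/
def kappa (n : ℕ) (ε : ℝ) (f : EuclideanSpace ℝ (Fin n) → ℝ)
    (Ω : Set (EuclideanSpace ℝ (Fin n))) : ℝ≥0∞ :=
  ENNReal.ofReal (ε ^ (n - 1)) *
    ⨆ (F : Set (Set (EuclideanSpace ℝ (Fin n))))
      (_ : ∀ Q ∈ F, IsCube n ε Q ∧ Q ⊆ Ω) (_ : F.Pairwise Disjoint),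
      ∑' Q : F, ENNReal.ofReal
        (⨍ x in (Q : Set (EuclideanSpace ℝ (Fin n))),
          |f x - ⨍ y in (Q : Set (EuclideanSpace ℝ (Fin n))), f y ∂volume| ∂volume)

/-- The divergence of a vector field on `ℝⁿ`. -/
def vdiv (n : ℕ) (Φ : EuclideanSpace ℝ (Fin n) → EuclideanSpace ℝ (Fin n))
    (x : EuclideanSpace ℝ (Fin n)) : ℝ :=
  ∑ i : Fin n, fderiv ℝ Φ x (EuclideanSpace.single i 1) i

/-- The variation `Var(f, Ω)`. -/
def variation (n : ℕ) (f : EuclideanSpace ℝ (Fin n) → ℝ)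
    (Ω : Set (EuclideanSpace ℝ (Fin n))) : ℝ≥0∞ :=
  ⨆ (Φ : EuclideanSpace ℝ (Fin n) → EuclideanSpace ℝ (Fin n))
    (_ : ContDiff ℝ 1 Φ) (_ : HasCompactSupport Φ) (_ : tsupport Φ ⊆ Ω)
    (_ : ∀ x, ‖Φ x‖ ≤ 1),
    ENNReal.ofReal (∫ x in Ω, f x * vdiv n Φ x)

/-- The approximate jump set `J_f`. -/
def jumpSet (n : ℕ) (f : EuclideanSpace ℝ (Fin n) → ℝ) : Set (EuclideanSpace ℝ (Fin n)) :=
  {x | ∃ ν : EuclideanSpace ℝ (Fin n), ‖ν‖ = 1 ∧ ∃ a b : ℝ, a ≠ b ∧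
    Tendsto (fun r : ℝ =>
        ⨍ y in {y ∈ ball x r | 0 < ⟪y - x, ν⟫}, |f y - a| ∂volume)
      (𝓝[>] 0) (𝓝 0) ∧
    Tendsto (fun r : ℝ =>
        ⨍ y in {y ∈ ball x r | ⟪y - x, ν⟫ < 0}, |f y - b| ∂volume)
      (𝓝[>] 0) (𝓝 0)}

/-- The approximate discontinuity set `S_f` (the set of non-Lebesgue points). -/
def approxDiscontSet (n : ℕ) (f : EuclideanSpace ℝ (Fin n) → ℝ) :
    Set (EuclideanSpace ℝ (Fin n)) :=
  {x | ¬ ∃ c : ℝ,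
    Tendsto (fun r : ℝ => ⨍ y in ball x r, |f y - c| ∂volume) (𝓝[>] 0) (𝓝 0)}

/-- `(μ, σ)` is the polar decomposition `Df = σ |Df|` of the gradient measure of `f` on `Ω`:
`μ` plays the role of the total variation measure `|Df|` and `σ` of the polar vector field. -/
def IsVariationPair (n : ℕ) (f : EuclideanSpace ℝ (Fin n) → ℝ)
    (Ω : Set (EuclideanSpace ℝ (Fin n))) (μ : Measure (EuclideanSpace ℝ (Fin n)))
    (σ : EuclideanSpace ℝ (Fin n) → EuclideanSpace ℝ (Fin n)) : Prop :=
  IsFiniteMeasure μ ∧ μ Ωᶜ = 0 ∧ AEStronglyMeasurable σ μ ∧ (∀ᵐ x ∂μ, ‖σ x‖ = 1) ∧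
  ∀ Φ : EuclideanSpace ℝ (Fin n) → EuclideanSpace ℝ (Fin n),
    ContDiff ℝ 1 Φ → HasCompactSupport Φ → tsupport Φ ⊆ Ω →
    ∫ x in Ω, f x * vdiv n Φ x = - ∫ x, ⟪Φ x, σ x⟫ ∂μ

/-- `|D^a f|(Ω)`, the total variation of the absolutely continuous part of `Df`,
with the convention that it is `∞` if `f` is not of bounded variation in `Ω`. -/
def absVar (n : ℕ) (f : EuclideanSpace ℝ (Fin n) → ℝ)
    (Ω : Set (EuclideanSpace ℝ (Fin n))) : ℝ≥0∞ :=
  if h : ∃ p : Measure (EuclideanSpace ℝ (Fin n)) ×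
      (EuclideanSpace ℝ (Fin n) → EuclideanSpace ℝ (Fin n)),
      IsVariationPair n f Ω p.1 p.2 then
    volume.withDensity ((h.choose.1).rnDeriv volume) Ω
  else ⊤

/-- `|D^c f|(Ω)`, the total variation of the Cantor part of `Df`,
with the convention that it is `∞` if `f` is not of bounded variation in `Ω`. -/
def cantorVar (n : ℕ) (f : EuclideanSpace ℝ (Fin n) → ℝ)
    (Ω : Set (EuclideanSpace ℝ (Fin n))) : ℝ≥0∞ :=
  if h : ∃ p : Measure (EuclideanSpace ℝ (Fin n)) ×
      (EuclideanSpace ℝ (Fin n) → EuclideanSpace ℝ (Fin n)),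
      IsVariationPair n f Ω p.1 p.2 then
    (h.choose.1.singularPart volume) (Ω \ approxDiscontSet n f)
  else ⊤

/-- `|D^j f|(Ω)`, the total variation of the jump part of `Df`,
with the convention that it is `∞` if `f` is not of bounded variation in `Ω`. -/
def jumpVar (n : ℕ) (f : EuclideanSpace ℝ (Fin n) → ℝ)
    (Ω : Set (EuclideanSpace ℝ (Fin n))) : ℝ≥0∞ :=
  if h : ∃ p : Measure (EuclideanSpace ℝ (Fin n)) ×
      (EuclideanSpace ℝ (Fin n) → EuclideanSpace ℝ (Fin n)),
      IsVariationPair n f Ω p.1 p.2 then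
    (h.choose.1.singularPart volume) (jumpSet n f ∩ Ω)
  else ⊤

/-- `g` is the weak (distributional) gradient of `u` on `Ω`. -/
def HasWeakGradientOn (n : ℕ) (u : EuclideanSpace ℝ (Fin n) → ℝ)
    (g : EuclideanSpace ℝ (Fin n) → EuclideanSpace ℝ (Fin n))
    (Ω : Set (EuclideanSpace ℝ (Fin n))) : Prop :=
  ∀ φ : EuclideanSpace ℝ (Fin n) → ℝ,
    ContDiff ℝ 1 φ → HasCompactSupport φ → tsupport φ ⊆ Ω →
    ∀ k : Fin n,
      ∫ x in Ω, u x * fderiv ℝ φ x (EuclideanSpace.single k 1) =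
        - ∫ x in Ω, φ x * g x k

/-- `f ∈ BV(Ω)`: `f` is integrable on `Ω` and has finite variation in `Ω`. -/
def IsBVOn (n : ℕ) (f : EuclideanSpace ℝ (Fin n) → ℝ)
    (Ω : Set (EuclideanSpace ℝ (Fin n))) : Prop :=
  IntegrableOn f Ω volume ∧ variation n f Ω < ⊤

/-- `f ∈ SBV(Ω)`: `f ∈ BV(Ω)` and the Cantor part of `Df` vanishes. -/
def IsSBVOn (n : ℕ) (f : EuclideanSpace ℝ (Fin n) → ℝ)
    (Ω : Set (EuclideanSpace ℝ (Fin n))) : Prop :=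
  IsBVOn n f Ω ∧ cantorVar n f Ω = 0



section Boxes

variable {n : ℕ}

/-- The open cube with centre `c`, side length `s` and orientation `T`. -/
def orientedCube (T : EuclideanSpace ℝ (Fin n) ≃ₗᵢ[ℝ] EuclideanSpace ℝ (Fin n))
    (c : EuclideanSpace ℝ (Fin n)) (s : ℝ) : Set (EuclideanSpace ℝ (Fin n)) :=
  {x | ∀ i, |T.symm (x - c) i| < s / 2}

lemma isCube_orientedCube (T : EuclideanSpace ℝ (Fin n) ≃ₗᵢ[ℝ] EuclideanSpace ℝ (Fin n))
    (c : EuclideanSpace ℝ (Fin n)) (s : ℝ) : IsCube n s (orientedCube T c s) := by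
  refine ⟨T, c, ?_⟩
  ext x
  simp only [orientedCube, Set.mem_ofPred_eq, Set.mem_image]
  constructor
  · intro h
    exact ⟨T.symm (x - c), h, by simp⟩
  · rintro ⟨y, hy, rfl⟩
    simpa using hy

lemma isOpen_orientedCube (T : EuclideanSpace ℝ (Fin n) ≃ₗᵢ[ℝ] EuclideanSpace ℝ (Fin n))
    (c : EuclideanSpace ℝ (Fin n)) (s : ℝ) : IsOpen (orientedCube T c s) := by
  rw [orientedCube, Set.ofPred_forall]
  refine isOpen_iInter_of_finite fun i => ?_
  exact isOpen_lt (by fun_prop) continuous_const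

lemma measurePreserving_chart (T : EuclideanSpace ℝ (Fin n) ≃ₗᵢ[ℝ] EuclideanSpace ℝ (Fin n))
    (c : EuclideanSpace ℝ (Fin n)) :
    MeasurePreserving (fun x => WithLp.ofLp (T.symm (x - c))) volume volume := by
  have h1 := PiLp.volume_preserving_ofLp (Fin n)
  have h2 := T.symm.measurePreserving
  have h3 := measurePreserving_sub_right (volume : Measure (EuclideanSpace ℝ (Fin n))) c
  exact h1.comp (h2.comp h3)

lemma volume_Icc_box (T : EuclideanSpace ℝ (Fin n) ≃ₗᵢ[ℝ] EuclideanSpace ℝ (Fin n))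
    (c : EuclideanSpace ℝ (Fin n)) (a b : Fin n → ℝ) :
    volume {x | ∀ i, T.symm (x - c) i ∈ Set.Icc (a i) (b i)} =
      ∏ i, ENNReal.ofReal (b i - a i) := by
  rw [← Real.volume_Icc_pi, ← (measurePreserving_chart T c).measure_preimage
    measurableSet_Icc.nullMeasurableSet]
  congr 1
  ext x
  simp [Pi.le_def, forall_and]

lemma volume_Ioo_box (T : EuclideanSpace ℝ (Fin n) ≃ₗᵢ[ℝ] EuclideanSpace ℝ (Fin n))
    (c : EuclideanSpace ℝ (Fin n)) (a b : Fin n → ℝ) :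
    volume {x | ∀ i, T.symm (x - c) i ∈ Set.Ioo (a i) (b i)} =
      ∏ i, ENNReal.ofReal (b i - a i) := by
  rw [← Real.volume_pi_Ioo, ← (measurePreserving_chart T c).measure_preimage
    (MeasurableSet.univ_pi fun i => measurableSet_Ioo).nullMeasurableSet]
  congr 1
  ext x
  simp

lemma volume_orientedCube (T : EuclideanSpace ℝ (Fin n) ≃ₗᵢ[ℝ] EuclideanSpace ℝ (Fin n))
    (c : EuclideanSpace ℝ (Fin n)) {s : ℝ} (hs : 0 ≤ s) :
    volume (orientedCube T c s) = ENNReal.ofReal (s ^ n) := by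
  have := volume_Ioo_box T c (fun _ => -(s / 2)) (fun _ => s / 2)
  simp only [Set.mem_Ioo, ← abs_lt] at this
  rw [orientedCube, this]
  simp [ENNReal.ofReal_pow hs]

lemma volume_coord_eq (T : EuclideanSpace ℝ (Fin n) ≃ₗᵢ[ℝ] EuclideanSpace ℝ (Fin n))
    (c : EuclideanSpace ℝ (Fin n)) (i : Fin n) (t : ℝ) :
    volume {x | T.symm (x - c) i = t} = 0 := by
  have h := (measurePreserving_chart T c).measure_preimage
    (s := {z : Fin n → ℝ | z i = t})
    (measurableSet_eq_fun (measurable_pi_apply i) measurable_const).nullMeasurableSet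
  rw [Set.preimage_ofPred_eq] at h
  rw [h, volume_pi]
  exact Measure.pi_hyperplane (α := fun _ : Fin n => ℝ) _ i t

lemma disjoint_orientedCube {T : EuclideanSpace ℝ (Fin n) ≃ₗᵢ[ℝ] EuclideanSpace ℝ (Fin n)}
    {c d : EuclideanSpace ℝ (Fin n)} {s : ℝ} {i : Fin n} (h : s ≤ |T.symm (c - d) i|) :
    Disjoint (orientedCube T c s) (orientedCube T d s) := by
  rw [Set.disjoint_left]
  intro x hx hy
  have h1 := hx i
  have h2 := hy i
  have h3 : T.symm (c - d) i = T.symm (x - d) i - T.symm (x - c) i := by simp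
  rw [h3] at h
  have := abs_sub (T.symm (x - d) i) (T.symm (x - c) i)
  linarith

lemma norm_le_of_abs_coord_le {x : EuclideanSpace ℝ (Fin n)} {s : ℝ} (hs : 0 ≤ s)
    (h : ∀ i, |x i| ≤ s) : ‖x‖ ≤ n * s := by
  rw [EuclideanSpace.norm_eq]
  refine Real.sqrt_le_iff.2 ⟨by positivity, ?_⟩
  calc ∑ i, ‖x i‖ ^ 2 ≤ ∑ _i : Fin n, s ^ 2 := by
        refine Finset.sum_le_sum fun i _ => ?_
        have := h i
        rw [Real.norm_eq_abs]
        gcongr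
    _ = n * s ^ 2 := by simp
    _ ≤ (n * s) ^ 2 := by
        have : (n : ℝ) ≤ n ^ 2 := by
          exact_mod_cast Nat.le_self_pow two_ne_zero n
        nlinarith [sq_nonneg s]

lemma dist_le_of_abs_coord_le (T : EuclideanSpace ℝ (Fin n) ≃ₗᵢ[ℝ] EuclideanSpace ℝ (Fin n))
    {x c : EuclideanSpace ℝ (Fin n)} {s : ℝ} (hs : 0 ≤ s)
    (h : ∀ i, |T.symm (x - c) i| ≤ s) : dist x c ≤ n * s := by
  rw [dist_eq_norm, ← T.symm.norm_map]
  exact norm_le_of_abs_coord_le hs h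

end Boxes

/-- The mean oscillation of `f` on `Q`. -/
def meanOsc {n : ℕ} (f : EuclideanSpace ℝ (Fin n) → ℝ)
    (Q : Set (EuclideanSpace ℝ (Fin n))) : ℝ :=
  ⨍ x in Q, |f x - ⨍ y in Q, f y ∂volume| ∂volume

section Kappa

variable {n : ℕ}

lemma tsum_meanOsc_le_kappa {ι : Type*} {ε : ℝ} (hε : 0 < ε)
    {f : EuclideanSpace ℝ (Fin n) → ℝ}
    {Ω : Set (EuclideanSpace ℝ (Fin n))} (Q : ι → Set (EuclideanSpace ℝ (Fin n)))
    (hQ : ∀ i, IsCube n ε (Q i)) (hΩ : ∀ i, Q i ⊆ Ω) (hd : Pairwise fun i j => Disjoint (Q i) (Q j)) :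
    ∑' i, ENNReal.ofReal (ε ^ (n - 1)) * ENNReal.ofReal (meanOsc f (Q i)) ≤ kappa n ε f Ω := by
  rw [ENNReal.tsum_mul_left, kappa]
  gcongr
  have hne : ∀ i, (Q i).Nonempty := by
    intro i
    obtain ⟨T, x, h⟩ := hQ i
    exact ⟨x, h ▸ ⟨0, fun i => by simpa using hε, by simp⟩⟩
  have hinj : Function.Injective Q := by
    intro i j hij
    by_contra hne'
    have := hd hne'
    simp only [hij, disjoint_self] at this
    exact (hne j).ne_empty this
  refine le_iSup_of_le (Set.range Q) (le_iSup_of_le ?_ (le_iSup_of_le ?_ ?_))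
  · rintro _ ⟨i, rfl⟩
    exact ⟨hQ i, hΩ i⟩
  · rintro _ ⟨i, rfl⟩ _ ⟨j, rfl⟩ hij
    exact hd fun h => hij (h ▸ rfl)
  · rw [← (Equiv.ofInjective Q hinj).tsum_eq]
    rfl

lemma kappa_eq_iSup_subtype (ε : ℝ) (f : EuclideanSpace ℝ (Fin n) → ℝ)
    (Ω : Set (EuclideanSpace ℝ (Fin n))) :
    kappa n ε f Ω = ⨆ F : {F : Set (Set (EuclideanSpace ℝ (Fin n))) //
      (∀ Q ∈ F, IsCube n ε Q ∧ Q ⊆ Ω) ∧ F.Pairwise Disjoint},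
        ∑' Q : F.1, ENNReal.ofReal (ε ^ (n - 1)) * ENNReal.ofReal (meanOsc f (Q : Set _)) := by
  simp only [kappa, ENNReal.mul_iSup, ENNReal.tsum_mul_left, iSup_subtype, iSup_and]
  rfl

lemma kappa_add_le {ε : ℝ} {f : EuclideanSpace ℝ (Fin n) → ℝ}
    {U V W : Set (EuclideanSpace ℝ (Fin n))} (hε : 0 < ε) (hU : U ⊆ W) (hV : V ⊆ W)
    (hd : Disjoint U V) : kappa n ε f U + kappa n ε f V ≤ kappa n ε f W := by
  rw [kappa_eq_iSup_subtype, kappa_eq_iSup_subtype ε f V]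
  have hempty : ∀ U : Set (EuclideanSpace ℝ (Fin n)),
      Nonempty {F : Set (Set (EuclideanSpace ℝ (Fin n))) //
      (∀ Q ∈ F, IsCube n ε Q ∧ Q ⊆ U) ∧ F.Pairwise Disjoint} := fun U => ⟨∅, by simp, by simp⟩
  have := hempty U
  have := hempty V
  refine ENNReal.iSup_add_iSup_le ?_
  rintro ⟨F, hF, hFd⟩ ⟨G, hG, hGd⟩
  have := tsum_meanOsc_le_kappa (ι := F ⊕ G) (Ω := W) (f := f) hε
    (Sum.elim (fun Q => (Q : Set _)) (fun Q => (Q : Set _))) ?_ ?_ ?_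
  · rwa [Summable.tsum_sum ENNReal.summable ENNReal.summable] at this
  · rintro (Q | Q)
    · exact (hF _ Q.2).1
    · exact (hG _ Q.2).1
  · rintro (Q | Q)
    · exact (hF _ Q.2).2.trans hU
    · exact (hG _ Q.2).2.trans hV
  · rintro (P | P) (Q | Q) hPQ
    · exact hFd P.2 Q.2 fun h => hPQ (by rw [Subtype.ext h])
    · exact hd.mono (hF _ P.2).2 (hG _ Q.2).2
    · exact (hd.mono (hF _ Q.2).2 (hG _ P.2).2).symm
    · exact hGd P.2 Q.2 fun h => hPQ (by rw [Subtype.ext h])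

end Kappa

section HalfSpace

variable {n : ℕ}

lemma hasDerivAt_setIntegral_translate {ψ : EuclideanSpace ℝ (Fin n) → ℝ}
    (hψ : ContDiff ℝ 1 ψ) (hc : HasCompactSupport ψ) (w : EuclideanSpace ℝ (Fin n))
    (H : Set (EuclideanSpace ℝ (Fin n))) :
    HasDerivAt (fun t : ℝ => ∫ x in H, ψ (x + t • w)) (∫ x in H, fderiv ℝ ψ x w) 0 := by
  have hcont : Continuous fun x => fderiv ℝ ψ x w :=
    (hψ.continuous_fderiv one_ne_zero).clm_apply continuous_const
  have hcs : HasCompactSupport fun x => fderiv ℝ ψ x w := hc.fderiv_apply (𝕜 := ℝ) w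
  obtain ⟨D, hD⟩ := hcs.exists_bound_of_continuous hcont
  set K := cthickening ‖w‖ (tsupport ψ) with hK
  have hKc : IsCompact K := hc.isCompact.cthickening
  have key := hasDerivAt_integral_of_dominated_loc_of_deriv_le (𝕜 := ℝ)
    (μ := volume.restrict H) (F := fun t x => ψ (x + t • w))
    (F' := fun t x => fderiv ℝ ψ (x + t • w) w) (x₀ := 0) (s := Set.Ioo (-1) 1)
    (bound := K.indicator fun _ => D)
    (Ioo_mem_nhds (by norm_num) (by norm_num)) ?_ ?_ ?_ ?_ ?_ ?_
  · simpa using key.2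
  · refine Eventually.of_forall fun t => ?_
    exact (hψ.continuous.comp (by fun_prop)).aestronglyMeasurable
  · simpa using (hψ.continuous.integrable_of_hasCompactSupport hc).restrict (s := H)
  · exact (hcont.comp (by fun_prop)).aestronglyMeasurable
  · refine Eventually.of_forall fun x t ht => ?_
    by_cases hx : x ∈ K
    · simpa [hx] using hD (x + t • w)
    · have : x + t • w ∉ tsupport ψ := by
        intro h
        apply hx
        refine mem_cthickening_of_dist_le x _ _ _ h ?_
        rw [dist_eq_norm]
        have : x - (x + t • w) = -(t • w) := by abel
        rw [this, norm_neg, norm_smul]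
        have : |t| ≤ 1 := abs_le.2 ⟨ht.1.le, ht.2.le⟩
        exact mul_le_of_le_one_left (norm_nonneg _) this
      have h0 : fderiv ℝ ψ (x + t • w) = 0 := by
        by_contra h0
        exact this (support_fderiv_subset ℝ (Function.mem_support.2 h0))
      simp [hx, h0]
  · exact ((integrable_indicator_iff hKc.measurableSet).2
      (integrableOn_const hKc.measure_lt_top.ne)).integrableOn
  · refine Eventually.of_forall fun x t ht => ?_
    have h1 : HasFDerivAt ψ (fderiv ℝ ψ (x + t • w)) (x + t • w) :=
      (hψ.differentiable one_ne_zero _).hasFDerivAt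
    have h2 : HasDerivAt (fun t : ℝ => x + t • w) w t := by
      simpa using ((hasDerivAt_id t).smul_const w).const_add x
    exact h1.comp_hasDerivAt t h2

lemma integral_fderiv_apply_eq_zero {ψ : EuclideanSpace ℝ (Fin n) → ℝ}
    (hψ : ContDiff ℝ 1 ψ) (hc : HasCompactSupport ψ) (w : EuclideanSpace ℝ (Fin n)) :
    ∫ x, fderiv ℝ ψ x w = 0 := by
  have h := hasDerivAt_setIntegral_translate hψ hc w Set.univ
  simp only [Measure.restrict_univ, integral_add_right_eq_self] at h
  exact h.unique (hasDerivAt_const _ _)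

lemma abs_integral_halfSpace_fderiv_le
    (T : EuclideanSpace ℝ (Fin n) ≃ₗᵢ[ℝ] EuclideanSpace ℝ (Fin n))
    (q : EuclideanSpace ℝ (Fin n)) {s : ℝ} (hs : 0 ≤ s) (i₀ : Fin n)
    {ψ : EuclideanSpace ℝ (Fin n) → ℝ} (hψ : ContDiff ℝ 1 ψ) (hc : HasCompactSupport ψ)
    (h01 : ∀ x, ψ x ∈ Set.Icc 0 1)
    (hsupp : ∀ x, ψ x ≠ 0 → ∀ i, |T.symm (x - q) i| ≤ s / 2)
    {w : EuclideanSpace ℝ (Fin n)} (hw : ‖w‖ ≤ 1) :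
    |∫ x in {x | 0 < T.symm (x - q) i₀}, fderiv ℝ ψ x w| ≤ s ^ (n - 1) := by
  set H : Set (EuclideanSpace ℝ (Fin n)) := {x | 0 < T.symm (x - q) i₀} with hH
  have hHm : MeasurableSet H := (isOpen_lt continuous_const (by fun_prop)).measurableSet
  have hderiv := hasDerivAt_setIntegral_translate hψ hc w H
  rw [← Real.norm_eq_abs]
  refine hderiv.le_of_lip' (by positivity) (Eventually.of_forall fun t => ?_)
  have hψi : Integrable ψ := hψ.continuous.integrable_of_hasCompactSupport hc
  set w₀ := T.symm w i₀ with hw₀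
  have hw₀1 : |w₀| ≤ 1 := by
    rw [← Real.norm_eq_abs]
    exact (PiLp.norm_apply_le _ _).trans ((T.symm.norm_map w).le.trans hw)
  set l : Fin n → ℝ := fun i => if i = i₀ then min 0 (t * w₀) else -(s / 2) with hl
  set u : Fin n → ℝ := fun i => if i = i₀ then max 0 (t * w₀) else s / 2 with hu
  set S := {x | ∀ i, T.symm (x - q) i ∈ Set.Icc (l i) (u i)} with hS
  have hSm : MeasurableSet S := by
    rw [hS, Set.ofPred_forall]
    refine MeasurableSet.iInter fun i => ?_
    exact (isClosed_Icc.preimage (by fun_prop : Continuous fun x => T.symm (x - q) i)).measurableSet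
  have hSv : volume S = ENNReal.ofReal (|t * w₀| * s ^ (n - 1)) := by
    rw [hS, volume_Icc_box, ← Finset.mul_prod_erase _ _ (Finset.mem_univ i₀),
      ENNReal.ofReal_mul (abs_nonneg _)]
    congr 1
    · simp only [hl, hu, if_true]
      congr 1
      rw [max_sub_min_eq_abs]
      simp
    · rw [Finset.prod_congr rfl (g := fun _ => ENNReal.ofReal s)]
      · simp [Finset.card_erase_of_mem, ENNReal.ofReal_pow hs]
      · intro i hi
        simp only [hl, hu, if_neg (Finset.ne_of_mem_erase hi)]
        congr 1
        ring
  have e1 : ∫ x in H, ψ (x + t • w) = ∫ x, (H.indicator 1 (x - t • w)) * ψ x := by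
    rw [← integral_indicator hHm,
      ← integral_sub_right_eq_self (fun x => H.indicator (fun x => ψ (x + t • w)) x) (t • w)]
    refine integral_congr_ae (Eventually.of_forall fun x => ?_)
    by_cases hx : x - t • w ∈ H <;> simp [hx]
  have e2 : ∫ x in H, ψ (x + (0 : ℝ) • w) = ∫ x, (H.indicator 1 x) * ψ x := by
    rw [← integral_indicator hHm]
    refine integral_congr_ae (Eventually.of_forall fun x => ?_)
    by_cases hx : x ∈ H <;> simp [hx]
  have i1 : Integrable fun x => (H.indicator 1 (x - t • w)) * ψ x := by
    refine hψi.bdd_mul (c := 1) ?_ (Eventually.of_forall fun x => ?_)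
    · exact ((measurable_one.indicator hHm).comp (measurable_id.sub_const _)).aestronglyMeasurable
    · by_cases hx : x - t • w ∈ H <;> simp [hx]
  have i2 : Integrable fun x => (H.indicator 1 x) * ψ x := by
    refine hψi.bdd_mul (c := 1) ?_ (Eventually.of_forall fun x => ?_)
    · exact (measurable_one.indicator hHm).aestronglyMeasurable
    · by_cases hx : x ∈ H <;> simp [hx]
  rw [e1, e2, ← integral_sub i1 i2]
  have hSfin : volume S ≠ ⊤ := by rw [hSv]; exact ENNReal.ofReal_ne_top
  calc ‖∫ x, ((H.indicator 1 (x - t • w)) * ψ x - (H.indicator 1 x) * ψ x)‖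
      ≤ ∫ x, S.indicator (fun _ => (1 : ℝ)) x := by
        refine norm_integral_le_of_norm_le
          ((integrable_indicator_iff hSm).2 (integrableOn_const hSfin))
          (Eventually.of_forall fun x => ?_)
        rw [← sub_mul, norm_mul]
        by_cases hx0 : ψ x = 0
        · rw [hx0, norm_zero, mul_zero]
          exact Set.indicator_nonneg (fun _ _ => zero_le_one) _
        have hψ1 : ‖ψ x‖ ≤ 1 := by
          rw [Real.norm_eq_abs, abs_le]
          constructor <;> linarith [(h01 x).1, (h01 x).2]
        have hcoord : T.symm (x - t • w - q) i₀ = T.symm (x - q) i₀ - t * w₀ := by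
          have : x - t • w - q = (x - q) - t • w := by abel
          rw [this, map_sub, map_smul]
          simp [hw₀]
        have hmem1 : (x - t • w ∈ H) ↔ t * w₀ < T.symm (x - q) i₀ := by
          rw [hH, Set.mem_ofPred_eq, hcoord, sub_pos]
        have hmem2 : (x ∈ H) ↔ 0 < T.symm (x - q) i₀ := Iff.rfl
        have hxS : ¬ ((x - t • w ∈ H) ↔ (x ∈ H)) → x ∈ S := by
          intro h i
          by_cases hi : i = i₀
          · subst hi
            simp only [hl, hu, if_true]
            rw [hmem1, hmem2] at h
            rw [Set.mem_Icc, min_le_iff, le_max_iff]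
            by_contra hcon
            apply h
            constructor <;> intro h' <;> by_contra h'' <;> apply hcon <;>
              constructor <;> grind
          · simp only [hl, hu, if_neg hi]
            exact abs_le.1 (hsupp x hx0 i)
        by_cases hx1 : x - t • w ∈ H <;> by_cases hx2 : x ∈ H <;>
          simp only [hx1, hx2, Set.indicator_of_mem, Set.indicator_of_notMem, not_false_eq_true,
            Pi.one_apply, sub_self, norm_zero, zero_mul, sub_zero, zero_sub, norm_neg, norm_one,
            one_mul]
        · exact Set.indicator_nonneg (fun _ _ => zero_le_one) _
        · rwa [Set.indicator_of_mem (hxS (by simp [hx1, hx2]))]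
        · rwa [Set.indicator_of_mem (hxS (by simp [hx1, hx2]))]
        · exact Set.indicator_nonneg (fun _ _ => zero_le_one) _
    _ = |t * w₀| * s ^ (n - 1) := by
        rw [integral_indicator hSm, setIntegral_const, Measure.real, hSv,
          ENNReal.toReal_ofReal (by positivity)]
        simp
    _ ≤ s ^ (n - 1) * ‖t - 0‖ := by
        rw [abs_mul, sub_zero, Real.norm_eq_abs]
        have : 0 ≤ |t| * s ^ (n - 1) := by positivity
        nlinarith

end HalfSpace

section JumpFunction

variable {n : ℕ}

/-- The function with value `a` where `0 < φ` and value `b` elsewhere. -/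
def stepFun {α : Type*} (φ : α → ℝ) (a b : ℝ) (x : α) : ℝ := if 0 < φ x then a else b

lemma measurable_stepFun {α : Type*} [MeasurableSpace α] {φ : α → ℝ} (hφ : Measurable φ)
    (a b : ℝ) : Measurable (stepFun φ a b) :=
  Measurable.ite (measurableSet_lt measurable_const hφ) measurable_const measurable_const

lemma norm_stepFun_le {α : Type*} (φ : α → ℝ) (a b : ℝ) (x : α) :
    ‖stepFun φ a b x‖ ≤ |a| + |b| := by
  rw [stepFun, Real.norm_eq_abs]
  split_ifs
  · linarith [abs_nonneg b]
  · linarith [abs_nonneg a]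

lemma integrableOn_stepFun {φ : EuclideanSpace ℝ (Fin n) → ℝ} (hφ : Measurable φ) (a b : ℝ)
    {s : Set (EuclideanSpace ℝ (Fin n))} (hs : volume s ≠ ⊤) :
    IntegrableOn (stepFun φ a b) s :=
  Measure.integrableOn_of_bounded hs (measurable_stepFun hφ a b).aestronglyMeasurable
    (Eventually.of_forall (norm_stepFun_le φ a b))

lemma volume_half_orientedCube_pos
    (T : EuclideanSpace ℝ (Fin n) ≃ₗᵢ[ℝ] EuclideanSpace ℝ (Fin n))
    (q : EuclideanSpace ℝ (Fin n)) {s : ℝ} (hs : 0 ≤ s) (i₀ : Fin n) :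
    volume.real (orientedCube T q s ∩ {x | 0 < T.symm (x - q) i₀}) = s ^ n / 2 ∧
    volume.real (orientedCube T q s ∩ {x | T.symm (x - q) i₀ < 0}) = s ^ n / 2 := by
  have hn : 0 < n := i₀.pos
  have hprod : ∀ l u : Fin n → ℝ, (u i₀ - l i₀ = s / 2) → (∀ i ≠ i₀, u i - l i = s) →
      (∏ i, ENNReal.ofReal (u i - l i)).toReal = s ^ n / 2 := by
    intro l u h0 h1
    rw [← Finset.mul_prod_erase _ _ (Finset.mem_univ i₀), h0,
      Finset.prod_congr rfl (g := fun _ => ENNReal.ofReal s)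
        fun i hi => by rw [h1 i (Finset.ne_of_mem_erase hi)]]
    simp only [Finset.prod_const, Finset.card_erase_of_mem (Finset.mem_univ i₀),
      Finset.card_univ, Fintype.card_fin, ENNReal.toReal_mul, ENNReal.toReal_pow,
      ENNReal.toReal_ofReal hs, ENNReal.toReal_ofReal (by positivity : (0 : ℝ) ≤ s / 2)]
    rw [div_mul_eq_mul_div, mul_pow_sub_one hn.ne']
  constructor
  · have : orientedCube T q s ∩ {x | 0 < T.symm (x - q) i₀} =
        {x | ∀ i, T.symm (x - q) i ∈ Set.Ioo (if i = i₀ then 0 else -(s / 2)) (s / 2)} := by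
      ext x
      simp only [orientedCube, Set.mem_inter_iff, Set.mem_ofPred_eq, abs_lt, Set.mem_Ioo]
      constructor
      · rintro ⟨h1, h2⟩ i
        refine ⟨?_, (h1 i).2⟩
        split_ifs with hi
        · rwa [hi]
        · exact (h1 i).1
      · intro h
        have h0 := h i₀
        simp only [if_true] at h0
        refine ⟨fun i => ⟨?_, (h i).2⟩, h0.1⟩
        by_cases hi : i = i₀
        · subst hi; linarith [h0.1]
        · simpa [hi] using (h i).1
    rw [this, Measure.real, volume_Ioo_box]
    exact hprod _ _ (by simp) fun i hi => by simp [hi]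
  · have : orientedCube T q s ∩ {x | T.symm (x - q) i₀ < 0} =
        {x | ∀ i, T.symm (x - q) i ∈ Set.Ioo (-(s / 2)) (if i = i₀ then 0 else s / 2)} := by
      ext x
      simp only [orientedCube, Set.mem_inter_iff, Set.mem_ofPred_eq, abs_lt, Set.mem_Ioo]
      constructor
      · rintro ⟨h1, h2⟩ i
        refine ⟨(h1 i).1, ?_⟩
        split_ifs with hi
        · rwa [hi]
        · exact (h1 i).2
      · intro h
        have h0 := h i₀
        simp only [if_true] at h0
        refine ⟨fun i => ⟨(h i).1, ?_⟩, h0.2⟩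
        by_cases hi : i = i₀
        · subst hi; linarith [h0.2]
        · simpa [hi] using (h i).2
    rw [this, Measure.real, volume_Ioo_box]
    exact hprod _ _ (by simp) fun i hi => by simp [hi]

lemma pow_mul_meanOsc (T : EuclideanSpace ℝ (Fin n) ≃ₗᵢ[ℝ] EuclideanSpace ℝ (Fin n))
    (q : EuclideanSpace ℝ (Fin n)) {s : ℝ} (hs : 0 ≤ s) (f : EuclideanSpace ℝ (Fin n) → ℝ) :
    s ^ n * meanOsc f (orientedCube T q s) =
      ∫ x in orientedCube T q s, |f x - ⨍ y in orientedCube T q s, f y| := by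
  have hv := volume_orientedCube T q hs
  have h := measure_smul_setAverage (μ := volume)
    (fun x => |f x - ⨍ y in orientedCube T q s, f y|) (s := orientedCube T q s)
    (by rw [hv]; exact ENNReal.ofReal_ne_top)
  rwa [Measure.real, hv, ENNReal.toReal_ofReal (by positivity)] at h

lemma half_jump_le_meanOsc_add
    (T : EuclideanSpace ℝ (Fin n) ≃ₗᵢ[ℝ] EuclideanSpace ℝ (Fin n))
    (q : EuclideanSpace ℝ (Fin n)) {s : ℝ} (hs : 0 ≤ s) (i₀ : Fin n) (a b : ℝ)
    {f : EuclideanSpace ℝ (Fin n) → ℝ} (hf : IntegrableOn f (orientedCube T q s)) :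
    |a - b| / 2 * s ^ n ≤ s ^ n * meanOsc f (orientedCube T q s) +
      ∫ x in orientedCube T q s, |f x - stepFun (fun x => T.symm (x - q) i₀) a b x| := by
  rw [pow_mul_meanOsc T q hs]
  set Q := orientedCube T q s
  set c := ⨍ y in Q, f y
  set u := stepFun (fun x => T.symm (x - q) i₀) a b with hu
  have hQm : MeasurableSet Q := (isOpen_orientedCube T q s).measurableSet
  have hQ : volume Q ≠ ⊤ := by rw [volume_orientedCube T q hs]; exact ENNReal.ofReal_ne_top
  have hmeas : Measurable fun x : EuclideanSpace ℝ (Fin n) => T.symm (x - q) i₀ :=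
    (by fun_prop : Continuous fun x : EuclideanSpace ℝ (Fin n) => T.symm (x - q) i₀).measurable
  have hui : IntegrableOn u Q := integrableOn_stepFun hmeas a b hQ
  have hci : IntegrableOn (fun _ : EuclideanSpace ℝ (Fin n) => c) Q := integrableOn_const hQ
  have h1 : IntegrableOn (fun x => |f x - c|) Q := (hf.sub hci).abs
  have h2 : IntegrableOn (fun x => |f x - u x|) Q := (hf.sub hui).abs
  have h3 : IntegrableOn (fun x => |u x - c|) Q := (hui.sub hci).abs
  have hP : MeasurableSet {x : EuclideanSpace ℝ (Fin n) | 0 < T.symm (x - q) i₀} :=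
    measurableSet_lt measurable_const hmeas
  have hN : MeasurableSet {x : EuclideanSpace ℝ (Fin n) | T.symm (x - q) i₀ < 0} :=
    measurableSet_lt hmeas measurable_const
  obtain ⟨hvP, hvN⟩ := volume_half_orientedCube_pos T q hs i₀
  calc |a - b| / 2 * s ^ n ≤ |a - c| * (s ^ n / 2) + |b - c| * (s ^ n / 2) := by
        have h4 : |a - b| ≤ |a - c| + |b - c| := by
          rw [abs_sub_comm b c]; exact abs_sub_le a c b
        have : 0 ≤ s ^ n := by positivity
        nlinarith
    _ = (∫ x in Q ∩ {x | 0 < T.symm (x - q) i₀}, |u x - c|) +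
        ∫ x in Q ∩ {x | T.symm (x - q) i₀ < 0}, |u x - c| := by
        congr 1
        · rw [setIntegral_congr_fun (g := fun _ => |a - c|) (hQm.inter hP), setIntegral_const,
            hvP, smul_eq_mul, mul_comm]
          intro x hx
          have : 0 < T.symm (x - q) i₀ := hx.2
          simp only [hu, stepFun, if_pos this]
        · rw [setIntegral_congr_fun (g := fun _ => |b - c|) (hQm.inter hN), setIntegral_const,
            hvN, smul_eq_mul, mul_comm]
          intro x hx
          have : T.symm (x - q) i₀ < 0 := hx.2
          simp only [hu, stepFun, if_neg this.not_gt]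
    _ = ∫ x in (Q ∩ {x | 0 < T.symm (x - q) i₀}) ∪ (Q ∩ {x | T.symm (x - q) i₀ < 0}),
          |u x - c| := by
        refine (setIntegral_union ?_ (hQm.inter hN) (h3.mono_set Set.inter_subset_left)
          (h3.mono_set Set.inter_subset_left)).symm
        rw [Set.disjoint_left]
        rintro x ⟨_, h1⟩ ⟨_, h2⟩
        exact lt_asymm (show 0 < T.symm (x - q) i₀ from h1) h2
    _ ≤ ∫ x in Q, |u x - c| := by
        refine setIntegral_mono_set h3 (Eventually.of_forall fun x => abs_nonneg _) ?_
        exact (Set.union_subset Set.inter_subset_left Set.inter_subset_left).eventuallyLE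
    _ ≤ ∫ x in Q, (|f x - c| + |f x - u x|) := by
        refine integral_mono h3 (h1.add h2) fun x => ?_
        have := abs_sub_le (u x) (f x) c
        rw [abs_sub_comm (u x) (f x)] at this
        simp only
        linarith
    _ = _ := integral_add h1 h2

lemma abs_integral_mul_fderiv_le
    (T : EuclideanSpace ℝ (Fin n) ≃ₗᵢ[ℝ] EuclideanSpace ℝ (Fin n))
    (q : EuclideanSpace ℝ (Fin n)) {s : ℝ} (hs : 0 ≤ s) (i₀ : Fin n) (a b : ℝ)
    {ψ : EuclideanSpace ℝ (Fin n) → ℝ} (hψ : ContDiff ℝ 1 ψ) (hc : HasCompactSupport ψ)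
    (h01 : ∀ x, ψ x ∈ Set.Icc 0 1)
    (hsupp : ∀ x, ψ x ≠ 0 → ∀ i, |T.symm (x - q) i| ≤ s / 2)
    {w : EuclideanSpace ℝ (Fin n)} (hw : ‖w‖ ≤ 1) {D : ℝ}
    (hD : ∀ x, |fderiv ℝ ψ x w| ≤ D) {f : EuclideanSpace ℝ (Fin n) → ℝ}
    {B : Set (EuclideanSpace ℝ (Fin n))} (hBv : volume B ≠ ⊤)
    (hf : IntegrableOn f B) (hB : tsupport ψ ⊆ B) :
    |∫ x in B, f x * fderiv ℝ ψ x w| ≤ |a - b| * s ^ (n - 1) +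
      D * ∫ x in B, |f x - stepFun (fun x => T.symm (x - q) i₀) a b x| := by
  set φ := fun x : EuclideanSpace ℝ (Fin n) => T.symm (x - q) i₀
  have hmeas : Measurable φ :=
    (by fun_prop : Continuous fun x : EuclideanSpace ℝ (Fin n) => T.symm (x - q) i₀).measurable
  set u := stepFun φ a b with hu
  have hui : IntegrableOn u B := integrableOn_stepFun hmeas a b hBv
  have hfu : IntegrableOn (fun x => f x - u x) B := hf.sub hui
  have hcont : Continuous fun x => fderiv ℝ ψ x w :=
    (hψ.continuous_fderiv one_ne_zero).clm_apply continuous_const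
  have hcs : HasCompactSupport fun x => fderiv ℝ ψ x w := hc.fderiv_apply (𝕜 := ℝ) w
  have hInt : Integrable fun x => fderiv ℝ ψ x w := hcont.integrable_of_hasCompactSupport hcs
  have hP : MeasurableSet {x | 0 < φ x} := measurableSet_lt measurable_const hmeas
  have hzero : ∀ x ∉ B, fderiv ℝ ψ x w = 0 := by
    intro x hx
    by_contra h
    apply hx
    apply hB
    refine support_fderiv_subset ℝ (Function.mem_support.2 fun h0 => h ?_)
    rw [h0]; rfl
  have hu_eq : ∫ x in B, u x * fderiv ℝ ψ x w =
      (a - b) * ∫ x in {x | 0 < φ x}, fderiv ℝ ψ x w := by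
    rw [setIntegral_eq_integral_of_forall_compl_eq_zero fun x hx => by rw [hzero x hx, mul_zero]]
    have : ∀ x, u x * fderiv ℝ ψ x w = b * fderiv ℝ ψ x w +
        (a - b) * {x | 0 < φ x}.indicator (fun x => fderiv ℝ ψ x w) x := by
      intro x
      by_cases hx : 0 < φ x
      · rw [Set.indicator_of_mem (show x ∈ {x | 0 < φ x} from hx), hu, stepFun, if_pos hx]; ring
      · rw [Set.indicator_of_notMem (show x ∉ {x | 0 < φ x} from hx), hu, stepFun, if_neg hx]; ring
    simp_rw [this]
    rw [integral_add (hInt.const_mul _) ((hInt.indicator hP).const_mul _), integral_const_mul,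
      integral_const_mul, integral_fderiv_apply_eq_zero hψ hc, integral_indicator hP]
    ring
  have hi1 : IntegrableOn (fun x => (f x - u x) * fderiv ℝ ψ x w) B :=
    hfu.mul_bdd (c := D) hcont.aestronglyMeasurable (Eventually.of_forall hD)
  have hi2 : IntegrableOn (fun x => u x * fderiv ℝ ψ x w) B :=
    hui.mul_bdd (c := D) hcont.aestronglyMeasurable (Eventually.of_forall hD)
  have hsplit : ∫ x in B, f x * fderiv ℝ ψ x w =
      (∫ x in B, u x * fderiv ℝ ψ x w) + ∫ x in B, (f x - u x) * fderiv ℝ ψ x w := by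
    rw [← integral_add hi2 hi1]
    congr 1 with x
    ring
  rw [hsplit, hu_eq]
  refine (abs_add_le _ _).trans (add_le_add ?_ ?_)
  · rw [abs_mul]
    gcongr
    exact abs_integral_halfSpace_fderiv_le T q hs i₀ hψ hc h01 hsupp hw
  · rw [← integral_const_mul, ← Real.norm_eq_abs]
    refine norm_integral_le_of_norm_le (hfu.abs.const_mul D) (Eventually.of_forall fun x => ?_)
    rw [norm_mul, mul_comm]
    exact mul_le_mul_of_nonneg_right (hD x) (norm_nonneg _)

end JumpFunction

section Cone

variable {n : ℕ}

/-- At all scales below `r`, `f` is `η`-close near `y` to the jump function with values `a`, `b`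
on both sides of the hyperplane through `y` orthogonal to the `i₀`-th axis of the frame `T`. -/
def IsNearJump (T : EuclideanSpace ℝ (Fin n) ≃ₗᵢ[ℝ] EuclideanSpace ℝ (Fin n)) (i₀ : Fin n)
    (a b η r : ℝ) (f : EuclideanSpace ℝ (Fin n) → ℝ) (Ω : Set (EuclideanSpace ℝ (Fin n)))
    (y : EuclideanSpace ℝ (Fin n)) : Prop :=
  closedBall y r ⊆ Ω ∧ ∀ ρ ∈ Set.Ioo 0 r,
    ∫ x in ball y ρ, |f x - stepFun (fun x => T.symm (x - y) i₀) a b x| ≤ η * |a - b| * ρ ^ n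

variable {T : EuclideanSpace ℝ (Fin n) ≃ₗᵢ[ℝ] EuclideanSpace ℝ (Fin n)} {i₀ : Fin n}
  {a b η r : ℝ} {f : EuclideanSpace ℝ (Fin n) → ℝ} {Ω : Set (EuclideanSpace ℝ (Fin n))}

lemma measurable_coord (T : EuclideanSpace ℝ (Fin n) ≃ₗᵢ[ℝ] EuclideanSpace ℝ (Fin n))
    (y : EuclideanSpace ℝ (Fin n)) (i₀ : Fin n) : Measurable fun x => T.symm (x - y) i₀ :=
  (by fun_prop : Continuous fun x : EuclideanSpace ℝ (Fin n) => T.symm (x - y) i₀).measurable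

lemma IsNearJump.integrableOn {y : EuclideanSpace ℝ (Fin n)}
    (h : IsNearJump T i₀ a b η r f Ω y) (hf : LocallyIntegrableOn f Ω) {ρ : ℝ} (hρ : ρ ≤ r) :
    IntegrableOn f (ball y ρ) :=
  (hf.integrableOn_compact_subset h.1 (isCompact_closedBall y r)).mono_set
    ((ball_subset_ball hρ).trans ball_subset_closedBall)

lemma abs_coord_le_norm (x : EuclideanSpace ℝ (Fin n)) (i : Fin n) : |x i| ≤ ‖x‖ :=
  PiLp.norm_apply_le x i

lemma IsNearJump.coord_sub_le {y y' : EuclideanSpace ℝ (Fin n)} {L : ℝ} (hab : a ≠ b)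
    (hf : LocallyIntegrableOn f Ω) (hL : 0 < L) (hL1 : L ≤ 1)
    (hη : η * (2 ^ n + L ^ n) <
      (L / 2) ^ n * volume.real (ball (0 : EuclideanSpace ℝ (Fin n)) 1))
    (h : IsNearJump T i₀ a b η r f Ω y) (h' : IsNearJump T i₀ a b η r f Ω y')
    (hr : 2 * ‖y' - y‖ < r) : T.symm (y' - y) i₀ ≤ L * ‖y' - y‖ := by
  by_contra! hlt
  set d := ‖y' - y‖ with hd
  have hd0 : 0 < d := by
    refine norm_pos_iff.2 fun h0 => ?_
    rw [hd, h0] at hlt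
    simp at hlt
  have hLd : 0 < L * d := by positivity
  have hLd' : L * d ≤ d := by nlinarith
  set z := y' - (L * d / 2) • T (EuclideanSpace.single i₀ 1) with hz
  have hzy : dist z y' = L * d / 2 := by
    rw [hz, dist_eq_norm]
    simp [norm_smul, abs_of_pos hL, abs_of_pos hd0]
  have hB' : ball z (L * d / 2) ⊆ ball y' (L * d) := by
    refine ball_subset_ball' ?_
    rw [hzy]; linarith
  have hB : ball z (L * d / 2) ⊆ ball y (2 * d) := by
    refine hB'.trans (ball_subset_ball' ?_)
    rw [dist_eq_norm, ← hd]; linarith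
  have hcoord : ∀ x ∈ ball z (L * d / 2),
      T.symm (x - y') i₀ < 0 ∧ 0 < T.symm (x - y) i₀ := by
    intro x hx
    have h1 : |T.symm (x - z) i₀| < L * d / 2 := by
      refine (abs_coord_le_norm _ _).trans_lt ?_
      rwa [T.symm.norm_map, ← dist_eq_norm]
    have h2 : T.symm (x - z) i₀ = T.symm (x - y') i₀ + L * d / 2 := by
      rw [hz]
      simp [map_sub]
      ring
    have h3 : T.symm (x - y) i₀ = T.symm (x - y') i₀ + T.symm (y' - y) i₀ := by simp
    rw [h2, abs_lt] at h1
    rw [h3]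
    exact ⟨by linarith, by linarith⟩
  have hvol : volume.real (ball z (L * d / 2)) =
      (L * d / 2) ^ n * volume.real (ball (0 : EuclideanSpace ℝ (Fin n)) 1) := by
    have hpos : 0 < L * d / 2 := by positivity
    rw [Measure.real, Measure.addHaar_ball_of_pos _ _ hpos, ENNReal.toReal_mul,
      finrank_euclideanSpace_fin, ENNReal.toReal_ofReal (by positivity), Measure.real]
  set u := stepFun (fun x => T.symm (x - y) i₀) a b with hu
  set u' := stepFun (fun x => T.symm (x - y') i₀) a b with hu'
  have hi : IntegrableOn (fun x => |f x - u x|) (ball y (2 * d)) :=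
    ((h.integrableOn hf hr.le).sub
      (integrableOn_stepFun (measurable_coord T y i₀) a b measure_ball_ne_top)).abs
  have hi' : IntegrableOn (fun x => |f x - u' x|) (ball y' (L * d)) :=
    ((h'.integrableOn hf (by linarith)).sub
      (integrableOn_stepFun (measurable_coord T y' i₀) a b measure_ball_ne_top)).abs
  have key : |a - b| * volume.real (ball z (L * d / 2)) ≤
      η * |a - b| * (2 * d) ^ n + η * |a - b| * (L * d) ^ n := by
    calc |a - b| * volume.real (ball z (L * d / 2))
        = ∫ x in ball z (L * d / 2), |a - b| := by
          rw [setIntegral_const, smul_eq_mul, mul_comm]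
      _ ≤ ∫ x in ball z (L * d / 2), (|f x - u x| + |f x - u' x|) := by
          refine setIntegral_mono_on (integrableOn_const measure_ball_ne_top)
            ((hi.mono_set hB).add (hi'.mono_set hB')) measurableSet_ball fun x hx => ?_
          obtain ⟨h1, h2⟩ := hcoord x hx
          simp only [hu, hu', stepFun, if_pos h2, if_neg h1.not_gt]
          rw [abs_sub_comm (f x) a]
          exact abs_sub_le a (f x) b
      _ = (∫ x in ball z (L * d / 2), |f x - u x|) + ∫ x in ball z (L * d / 2), |f x - u' x| :=
          integral_add (hi.mono_set hB) (hi'.mono_set hB')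
      _ ≤ (∫ x in ball y (2 * d), |f x - u x|) + ∫ x in ball y' (L * d), |f x - u' x| := by
          refine add_le_add (setIntegral_mono_set hi ?_ hB.eventuallyLE)
            (setIntegral_mono_set hi' ?_ hB'.eventuallyLE) <;>
          exact Eventually.of_forall fun x => abs_nonneg _
      _ ≤ _ := add_le_add (h.2 _ ⟨by positivity, hr⟩) (h'.2 _ ⟨hLd, by linarith⟩)
  rw [hvol] at key
  have hA : 0 < |a - b| := abs_pos.2 (sub_ne_zero.2 hab)
  have hdn : 0 < d ^ n := by positivity
  have e1 : (L * d / 2) ^ n = (L / 2) ^ n * d ^ n := by rw [← mul_pow]; ring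
  rw [e1, mul_pow, mul_pow] at key
  have := mul_lt_mul_of_pos_left hη (mul_pos hA hdn)
  linarith

lemma IsNearJump.abs_coord_sub_le {y y' : EuclideanSpace ℝ (Fin n)} {L : ℝ} (hab : a ≠ b)
    (hf : LocallyIntegrableOn f Ω) (hL : 0 < L) (hL1 : L ≤ 1)
    (hη : η * (2 ^ n + L ^ n) <
      (L / 2) ^ n * volume.real (ball (0 : EuclideanSpace ℝ (Fin n)) 1))
    (h : IsNearJump T i₀ a b η r f Ω y) (h' : IsNearJump T i₀ a b η r f Ω y')
    (hr : 2 * ‖y' - y‖ < r) : |T.symm (y' - y) i₀| ≤ L * ‖y' - y‖ := by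
  refine abs_le'.2 ⟨h.coord_sub_le hab hf hL hL1 hη h' hr, ?_⟩
  rw [norm_sub_rev] at hr ⊢
  rw [show -(T.symm (y' - y)) i₀ = T.symm (y - y') i₀ by simp]
  exact h'.coord_sub_le hab hf hL hL1 hη h hr

end Cone

section Cutoff

variable {n : ℕ}

lemma exists_cutoff_unitCube (n : ℕ) {δ : ℝ} (hδ : 0 < δ) :
    ∃ φ : EuclideanSpace ℝ (Fin n) → ℝ, ContDiff ℝ 1 φ ∧ HasCompactSupport φ ∧
      (∀ x, φ x ∈ Set.Icc 0 1) ∧ (∀ x, (∀ i, |x i| ≤ 1 / 2) → φ x = 1) ∧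
      ∀ x, φ x ≠ 0 → ∀ i, |x i| ≤ (1 + δ) / 2 := by
  set g : ℝ → ℝ := fun t =>
    Real.smoothTransition ((((1 + δ) / 2) ^ 2 - t ^ 2) / (((1 + δ) / 2) ^ 2 - (1 / 2) ^ 2)) with hg
  have hden : 0 < ((1 + δ) / 2) ^ 2 - (1 / 2) ^ 2 := by nlinarith
  have hsupp : ∀ x : EuclideanSpace ℝ (Fin n), ∏ i, g (x i) ≠ 0 → ∀ i, |x i| ≤ (1 + δ) / 2 := by
    intro x hx i
    by_contra! hlt
    refine hx (Finset.prod_eq_zero (Finset.mem_univ i) ?_)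
    refine Real.smoothTransition.zero_of_nonpos (div_nonpos_of_nonpos_of_nonneg ?_ hden.le)
    rw [← sq_abs (x i)]
    nlinarith
  refine ⟨fun x => ∏ i, g (x i), ?_, ?_, ?_, ?_, hsupp⟩
  · refine contDiff_prod fun i _ => Real.smoothTransition.contDiff.comp ?_
    refine ContDiff.div_const (contDiff_const.sub (ContDiff.pow ?_ 2)) _
    exact contDiff_euclidean.1 contDiff_id i
  · refine HasCompactSupport.of_support_subset_isCompact
      (isCompact_closedBall 0 (n * ((1 + δ) / 2))) fun x hx => ?_
    rw [mem_closedBall_zero_iff]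
    exact norm_le_of_abs_coord_le (by positivity) (hsupp x hx)
  · exact fun x => ⟨Finset.prod_nonneg fun i _ => Real.smoothTransition.nonneg _,
      Finset.prod_le_one (fun i _ => Real.smoothTransition.nonneg _)
        fun i _ => Real.smoothTransition.le_one _⟩
  · refine fun x hx => Finset.prod_eq_one fun i _ => Real.smoothTransition.one_of_one_le ?_
    rw [one_le_div hden]
    have := sq_le_sq' (abs_le.1 (hx i)).1 (abs_le.1 (hx i)).2
    linarith

lemma exists_cutoff_orientedCube (n : ℕ) {δ : ℝ} (hδ : 0 < δ) :
    ∃ D : ℝ, 0 ≤ D ∧ ∀ (T : EuclideanSpace ℝ (Fin n) ≃ₗᵢ[ℝ] EuclideanSpace ℝ (Fin n))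
      (q : EuclideanSpace ℝ (Fin n)) (ε : ℝ), 0 < ε →
      ∃ ψ : EuclideanSpace ℝ (Fin n) → ℝ, ContDiff ℝ 1 ψ ∧ HasCompactSupport ψ ∧
        (∀ x, ψ x ∈ Set.Icc 0 1) ∧ (∀ x, (∀ i, |T.symm (x - q) i| ≤ ε / 2) → ψ x = 1) ∧
        (∀ x, ψ x ≠ 0 → ∀ i, |T.symm (x - q) i| ≤ (1 + δ) * ε / 2) ∧
        ∀ x w, ‖w‖ ≤ 1 → |fderiv ℝ ψ x w| ≤ D / ε := by
  obtain ⟨φ, hφ, hc, h01, h1, hs⟩ := exists_cutoff_unitCube n hδ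
  obtain ⟨D, hD⟩ := (hc.fderiv (𝕜 := ℝ)).exists_bound_of_continuous
    (hφ.continuous_fderiv one_ne_zero)
  refine ⟨D, (norm_nonneg _).trans (hD 0), fun T q ε hε => ?_⟩
  have hψ : ContDiff ℝ 1 fun x => φ (ε⁻¹ • T.symm (x - q)) := by
    refine hφ.comp (ContDiff.const_smul ε⁻¹ ?_)
    exact T.symm.contDiff.comp (contDiff_id.sub contDiff_const)
  have hsupp : ∀ x, φ (ε⁻¹ • T.symm (x - q)) ≠ 0 →
      ∀ i, |T.symm (x - q) i| ≤ (1 + δ) * ε / 2 := by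
    intro x hx i
    have := hs _ hx i
    rw [PiLp.smul_apply, smul_eq_mul, abs_mul, abs_inv, abs_of_pos hε, inv_mul_le_iff₀ hε] at this
    linarith
  refine ⟨fun x => φ (ε⁻¹ • T.symm (x - q)), hψ, ?_, fun x => h01 _, fun x hx => h1 _ fun i => ?_,
    hsupp, fun x w hw => ?_⟩
  · refine HasCompactSupport.of_support_subset_isCompact
      (isCompact_closedBall q (n * ((1 + δ) * ε / 2))) fun x hx => ?_
    rw [mem_closedBall]
    exact dist_le_of_abs_coord_le T (by positivity) (hsupp x hx)
  · rw [PiLp.smul_apply, smul_eq_mul, abs_mul, abs_inv, abs_of_pos hε, inv_mul_le_iff₀ hε]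
    linarith [hx i]
  · have hlin : HasFDerivAt (fun x => ε⁻¹ • T.symm (x - q))
        (ε⁻¹ • (T.symm.toContinuousLinearEquiv :
          EuclideanSpace ℝ (Fin n) →L[ℝ] EuclideanSpace ℝ (Fin n))) x := by
      refine HasFDerivAt.fun_const_smul ?_ _
      exact T.symm.toContinuousLinearEquiv.hasFDerivAt.comp x ((hasFDerivAt_id x).sub_const q)
    have hd := ((hφ.differentiable one_ne_zero _).hasFDerivAt.comp x hlin).fderiv
    have he : fderiv ℝ (fun x => φ (ε⁻¹ • T.symm (x - q))) x w =
        fderiv ℝ φ (ε⁻¹ • T.symm (x - q)) (ε⁻¹ • T.symm w) := by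
      change fderiv ℝ (φ ∘ fun x => ε⁻¹ • T.symm (x - q)) x w = _
      rw [hd]
      rfl
    rw [he, map_smul, smul_eq_mul, abs_mul, abs_inv, abs_of_pos hε, mul_comm, ← div_eq_mul_inv]
    gcongr
    rw [← Real.norm_eq_abs]
    calc _ ≤ ‖fderiv ℝ φ (ε⁻¹ • T.symm (x - q))‖ * ‖T.symm w‖ := ContinuousLinearMap.le_opNorm _ _
      _ ≤ D * 1 := by
        gcongr
        · exact (norm_nonneg _).trans (hD 0)
        · exact hD _
        · rwa [T.symm.norm_map]
      _ = D := mul_one D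

end Cutoff

section Cell

variable {n : ℕ}

lemma vdiv_smul_const {ψ : EuclideanSpace ℝ (Fin n) → ℝ} (hψ : Differentiable ℝ ψ)
    (w x : EuclideanSpace ℝ (Fin n)) :
    vdiv n (fun x => ψ x • w) x = fderiv ℝ ψ x w := by
  have h1 : fderiv ℝ (fun x => ψ x • w) x = (fderiv ℝ ψ x).smulRight w :=
    ((hψ x).hasFDerivAt.smul_const w).fderiv
  have h2 : w = ∑ i, w i • EuclideanSpace.single i (1 : ℝ) := by
    ext j
    simp [Finset.sum_apply, Pi.single_apply]
  simp only [vdiv, h1, ContinuousLinearMap.smulRight_apply, PiLp.smul_apply, smul_eq_mul]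
  conv_rhs => rw [h2, map_sum]
  exact Finset.sum_congr rfl fun i _ => by rw [map_smul, smul_eq_mul, mul_comm]

variable {f : EuclideanSpace ℝ (Fin n) → ℝ} {Ω : Set (EuclideanSpace ℝ (Fin n))}
  {μ : Measure (EuclideanSpace ℝ (Fin n))}
  {σ : EuclideanSpace ℝ (Fin n) → EuclideanSpace ℝ (Fin n)}

lemma IsVariationPair.setIntegral_mul_fderiv (hp : IsVariationPair n f Ω μ σ)
    {ψ : EuclideanSpace ℝ (Fin n) → ℝ} (hψ : ContDiff ℝ 1 ψ) (hc : HasCompactSupport ψ)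
    {B : Set (EuclideanSpace ℝ (Fin n))} (hΩm : MeasurableSet Ω) (hB : tsupport ψ ⊆ B)
    (hBΩ : B ⊆ Ω)
    (w : EuclideanSpace ℝ (Fin n)) :
    ∫ x in B, f x * fderiv ℝ ψ x w = - ∫ x, ψ x * ⟪w, σ x⟫ ∂μ := by
  have hsub : tsupport (fun x => ψ x • w) ⊆ tsupport ψ := closure_mono fun x hx h0 => by
    simp [h0] at hx
  have h := hp.2.2.2.2 (fun x => ψ x • w) (hψ.smul contDiff_const)
    (hc.mono' (subset_closure.trans hsub)) (hsub.trans (hB.trans hBΩ))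
  simp_rw [vdiv_smul_const (hψ.differentiable one_ne_zero), inner_smul_left] at h
  rw [setIntegral_eq_of_subset_of_forall_sdiff_eq_zero hΩm hBΩ] at h
  · exact h
  · intro x hx
    rw [image_eq_zero_of_notMem_tsupport (f := fderiv ℝ ψ)
      fun hx' => hx.2 (hB (tsupport_fderiv_subset ℝ hx'))]
    simp

lemma cell_estimate (hp : IsVariationPair n f Ω μ σ) (hΩm : MeasurableSet Ω)
    (hf : LocallyIntegrableOn f Ω)
    {T : EuclideanSpace ℝ (Fin n) ≃ₗᵢ[ℝ] EuclideanSpace ℝ (Fin n)} {i₀ : Fin n}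
    {a b η r : ℝ} {y q : EuclideanSpace ℝ (Fin n)} (hy : IsNearJump T i₀ a b η r f Ω y)
    {ε : ℝ} (hε : 0 < ε) (hr : 3 * n * ε < r) (hq : ∀ i, |T.symm (q - y) i| ≤ ε)
    (hq0 : T.symm (q - y) i₀ = 0) {δ : ℝ} (hδ0 : 0 < δ) (hδ1 : δ < 1)
    {ψ : EuclideanSpace ℝ (Fin n) → ℝ} (hψ : ContDiff ℝ 1 ψ) (hc : HasCompactSupport ψ)
    (h01 : ∀ x, ψ x ∈ Set.Icc 0 1)
    (hs : ∀ x, ψ x ≠ 0 → ∀ i, |T.symm (x - q) i| ≤ (1 + δ) * ε / 2)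
    {w : EuclideanSpace ℝ (Fin n)} (hw : ‖w‖ ≤ 1) {D : ℝ} (hD0 : 0 ≤ D)
    (hD : ∀ x, |fderiv ℝ ψ x w| ≤ D / ε) :
    orientedCube T q ε ⊆ ball y (3 * n * ε) ∧ tsupport ψ ⊆ ball y (3 * n * ε) ∧
    |a - b| / 2 ≤ meanOsc f (orientedCube T q ε) + η * |a - b| * (3 * n) ^ n ∧
    ∫ x, ψ x * ⟪w, σ x⟫ ∂μ ≤
      |a - b| * ε ^ (n - 1) * ((1 + δ) ^ (n - 1) + D * η * (3 * n) ^ n) := by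
  have hn : 0 < n := i₀.pos
  have hn' : (0 : ℝ) < n := by exact_mod_cast hn
  set B := ball y (3 * n * ε)
  have hcoord : ∀ x i, T.symm (x - y) i = T.symm (x - q) i + T.symm (q - y) i := by
    intro x i; simp
  have hQB : orientedCube T q ε ⊆ B := by
    intro x hx
    rw [mem_ball]
    refine (dist_le_of_abs_coord_le T (s := 2 * ε) (by positivity) fun i => ?_).trans_lt
      (by nlinarith [mul_pos hn' hε])
    rw [hcoord]
    have := abs_add_le (T.symm (x - q) i) (T.symm (q - y) i)
    linarith [hx i, hq i]
  have hψB : tsupport ψ ⊆ B := by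
    have : tsupport ψ ⊆ closedBall y (n * (2 * ε)) := by
      refine closure_minimal (fun x hx => ?_) isClosed_closedBall
      rw [mem_closedBall]
      refine dist_le_of_abs_coord_le T (by positivity) fun i => ?_
      rw [hcoord]
      have := abs_add_le (T.symm (x - q) i) (T.symm (q - y) i)
      have := hs x hx i
      have := mul_lt_mul_of_pos_right hδ1 hε
      linarith [hq i]
    exact this.trans (closedBall_subset_ball (by nlinarith [mul_pos hn' hε]))
  have hBΩ : B ⊆ Ω := (ball_subset_closedBall.trans (closedBall_subset_closedBall hr.le)).trans hy.1
  have hfB : IntegrableOn f B := hy.integrableOn hf hr.le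
  have hstep : stepFun (fun x => T.symm (x - y) i₀) a b =
      stepFun (fun x => T.symm (x - q) i₀) a b := by
    ext x
    simp only [stepFun, hcoord x i₀, hq0, add_zero]
  have hI := hy.2 (3 * n * ε) ⟨by positivity, hr⟩
  rw [hstep, mul_pow (3 * (n : ℝ))] at hI
  have hεn : ε ^ n = ε ^ (n - 1) * ε := (pow_sub_one_mul hn.ne' ε).symm
  refine ⟨hQB, hψB, ?_, ?_⟩
  · have h := half_jump_le_meanOsc_add T q hε.le i₀ a b (hfB.mono_set hQB)
    have h2 : ∫ x in orientedCube T q ε, |f x - stepFun (fun x => T.symm (x - q) i₀) a b x| ≤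
        ∫ x in B, |f x - stepFun (fun x => T.symm (x - q) i₀) a b x| := by
      refine setIntegral_mono_set ?_ (Eventually.of_forall fun x => abs_nonneg _) hQB.eventuallyLE
      exact (hfB.sub (integrableOn_stepFun (measurable_coord T q i₀) a b measure_ball_ne_top)).abs
    have hpos : 0 < ε ^ n := by positivity
    refine le_of_mul_le_mul_right ?_ hpos
    linarith
  · have h := abs_integral_mul_fderiv_le T q (s := (1 + δ) * ε) (by positivity) i₀ a b hψ hc h01 hs
      hw hD measure_ball_ne_top hfB hψB
    rw [hp.setIntegral_mul_fderiv hψ hc hΩm hψB hBΩ, abs_neg] at h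
    refine (le_abs_self _).trans (h.trans ?_)
    rw [mul_pow]
    have : D / ε * ∫ x in B, |f x - stepFun (fun x => T.symm (x - q) i₀) a b x| ≤
        D / ε * (η * |a - b| * ((3 * n) ^ n * ε ^ n)) := by gcongr
    refine (add_le_add_right this _).trans_eq ?_
    rw [hεn]
    field_simp

end Cell

section Piece

variable {n : ℕ}

lemma sum_le_two_pow_of_lattice {S : Set (Fin n → ℤ)} [Fintype S] {v : S → ℝ} (t : Fin n → ℝ)
    (h1 : ∀ k, v k ≤ 1) (h : ∀ k, v k ≠ 0 → ∀ i, |t i - k.1 i| < 1) : ∑ k, v k ≤ 2 ^ n := by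
  calc ∑ k, v k = ∑ k with v k ≠ 0, v k := (Finset.sum_filter_ne_zero _).symm
    _ ≤ ∑ k with v k ≠ 0, (1 : ℝ) := Finset.sum_le_sum fun k _ => h1 k
    _ = (Finset.card (Finset.univ.filter fun k => v k ≠ 0) : ℝ) := by simp
    _ ≤ (Finset.card (Fintype.piFinset fun i => ({⌊t i⌋, ⌊t i⌋ + 1} : Finset ℤ)) : ℝ) := by
      refine Nat.cast_le.2 (Finset.card_le_card_of_injOn (fun k => k.1) (fun k hk => ?_)
        Subtype.val_injective.injOn)
      simp only [Finset.coe_filter, Finset.mem_univ, true_and, Set.mem_ofPred_eq] at hk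
      simp only [Finset.mem_coe, Fintype.mem_piFinset, Finset.mem_insert, Finset.mem_singleton]
      intro i
      obtain ⟨h2, h3⟩ := abs_lt.1 (h k hk i)
      have h4 : k.1 i < ⌊t i⌋ + 2 := by
        have := Int.lt_floor_add_one (t i)
        exact_mod_cast (by linarith : (k.1 i : ℝ) < ⌊t i⌋ + 2)
      have h5 : ⌊t i⌋ < k.1 i + 1 := by
        have := Int.floor_le (t i)
        exact_mod_cast (by linarith : (⌊t i⌋ : ℝ) < k.1 i + 1)
      omega
    _ ≤ 2 ^ n := by
      rw [Fintype.card_piFinset]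
      push_cast
      refine (Finset.prod_le_prod (g := fun _ => (2 : ℝ)) (fun i _ => by positivity)
        fun i _ => ?_).trans (by simp)
      exact_mod_cast Finset.card_le_two

variable {f : EuclideanSpace ℝ (Fin n) → ℝ} {Ω : Set (EuclideanSpace ℝ (Fin n))}
  {μ : Measure (EuclideanSpace ℝ (Fin n))}
  {σ : EuclideanSpace ℝ (Fin n) → EuclideanSpace ℝ (Fin n)}

lemma abs_coord_le_of_cone {z : EuclideanSpace ℝ (Fin n)} {i₀ : Fin n} {ε : ℝ} (hε : 0 ≤ ε)
    (hz : ∀ i ≠ i₀, |z i| ≤ 3 * ε / 2) (hc : |z i₀| ≤ 1 / (3 * n) * ‖z‖) : |z i₀| ≤ ε / 2 := by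
  have hn' : (0 : ℝ) < n := by exact_mod_cast i₀.pos
  have h : ‖z‖ ≤ n * max |z i₀| (3 * ε / 2) := by
    refine norm_le_of_abs_coord_le (le_max_of_le_left (abs_nonneg _)) fun i => ?_
    by_cases hi : i = i₀
    · rw [hi]; exact le_max_left _ _
    · exact le_max_of_le_right (hz i hi)
  have h2 : |z i₀| ≤ max |z i₀| (3 * ε / 2) / 3 := by
    calc |z i₀| ≤ 1 / (3 * n) * (n * max |z i₀| (3 * ε / 2)) := hc.trans (by gcongr)
      _ = _ := by field_simp
  rcases max_cases |z i₀| (3 * ε / 2) with ⟨h3, h4⟩ | ⟨h3, h4⟩ <;> rw [h3] at h2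
  · have := abs_nonneg (z i₀)
    linarith
  · linarith

/-- The measure of a compact set of jump points with nearly constant traces and normal is
controlled by the oscillation functional of a neighbourhood. -/
lemma measure_le_kappa_of_isNearJump (hp : IsVariationPair n f Ω μ σ) (hΩm : MeasurableSet Ω)
    (hf : LocallyIntegrableOn f Ω)
    {T : EuclideanSpace ℝ (Fin n) ≃ₗᵢ[ℝ] EuclideanSpace ℝ (Fin n)} {i₀ : Fin n}
    {a b η r : ℝ} {E K V : Set (EuclideanSpace ℝ (Fin n))} {c w : EuclideanSpace ℝ (Fin n)}
    (hab : a ≠ b) (hE : ∀ y ∈ E, IsNearJump T i₀ a b η r f Ω y) (hEc : E ⊆ ball c (r / 4))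
    (hK : IsCompact K) (hKE : K ⊆ closure E) (hw : ‖w‖ = 1) {δ : ℝ}
    (hσ : ∀ x ∈ K, ‖σ x - w‖ ≤ δ)
    (hδ0 : 0 < δ) (hδ1 : δ < 1)
    (hη : η * (2 ^ n + (1 / (3 * n)) ^ n) <
      (1 / (3 * n) / 2 : ℝ) ^ n * volume.real (ball (0 : EuclideanSpace ℝ (Fin n)) 1))
    {C D ε : ℝ} (hC : 0 ≤ C) (hD0 : 0 ≤ D)
    (hD : ∀ q : EuclideanSpace ℝ (Fin n),
      ∃ ψ : EuclideanSpace ℝ (Fin n) → ℝ, ContDiff ℝ 1 ψ ∧ HasCompactSupport ψ ∧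
        (∀ x, ψ x ∈ Set.Icc 0 1) ∧ (∀ x, (∀ i, |T.symm (x - q) i| ≤ ε / 2) → ψ x = 1) ∧
        (∀ x, ψ x ≠ 0 → ∀ i, |T.symm (x - q) i| ≤ (1 + δ) * ε / 2) ∧
        ∀ x w, ‖w‖ ≤ 1 → |fderiv ℝ ψ x w| ≤ D / ε)
    (hconst : 2 * ((1 + δ) ^ (n - 1) + D * η * (3 * n) ^ n) ≤
      C * (1 - δ) * (1 - 2 * η * (3 * n) ^ n))
    (hε : 0 < ε) (hr : 3 * n * ε < r) (hV : MeasurableSet V)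
    (hKV : thickening ((3 * n + 1) * ε) K ⊆ V) :
    μ K ≤ ENNReal.ofReal C * kappa n ε f V + ENNReal.ofReal (2 ^ n / (1 - δ)) * μ (V \ K) := by
  have := hp.1
  have hn' : (0 : ℝ) < n := by exact_mod_cast i₀.pos
  have hn1 : (1 : ℝ) ≤ n := by exact_mod_cast i₀.pos
  set cell : EuclideanSpace ℝ (Fin n) → Fin n → ℤ := fun x i =>
    if i = i₀ then 0 else round (T.symm x i / ε) with hcell
  have hround : ∀ x, ∀ i ≠ i₀, |T.symm x i - ε * cell x i| ≤ ε / 2 := by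
    intro x i hi
    have h := abs_sub_round (T.symm x i / ε)
    have e : T.symm x i - ε * cell x i = ε * (T.symm x i / ε - round (T.symm x i / ε)) := by
      simp only [hcell, if_neg hi]
      field_simp
    rw [e, abs_mul, abs_of_pos hε]
    nlinarith
  have hfin : (cell '' K).Finite := by
    obtain ⟨M, hM⟩ := hK.isBounded.exists_norm_le
    set m : ℤ := ⌈M / ε + 1⌉ with hm
    refine (Set.finite_Icc (fun _ => -m : Fin n → ℤ) (fun _ => m)).subset ?_
    rintro _ ⟨x, hx, rfl⟩
    have hmM : M / ε + 1 ≤ m := Int.le_ceil _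
    have hM0 : 0 ≤ M / ε := div_nonneg ((norm_nonneg x).trans (hM x hx)) hε.le
    have hb : ∀ i, |(cell x i : ℝ)| ≤ m := by
      intro i
      by_cases hi : i = i₀
      · simp only [hcell, if_pos hi, Int.cast_zero, abs_zero]
        linarith
      · have h1 := hround x i hi
        have h2 : |T.symm x i| ≤ M :=
          (abs_coord_le_norm _ i).trans ((T.symm.norm_map x).le.trans (hM x hx))
        have h3 : |ε * (cell x i : ℝ)| ≤ M + ε / 2 := by
          have := abs_sub_abs_le_abs_sub (ε * (cell x i : ℝ)) (T.symm x i)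
          rw [abs_sub_comm] at h1
          linarith
        rw [abs_mul, abs_of_pos hε, mul_comm, ← le_div_iff₀ hε, add_div] at h3
        have : ε / 2 / ε = 1 / 2 := by field_simp
        linarith
    refine ⟨fun i => ?_, fun i => ?_⟩
    · exact_mod_cast (abs_le.1 (hb i)).1
    · exact_mod_cast (abs_le.1 (hb i)).2
  have : Fintype (cell '' K) := hfin.fintype
  have hpt : ∀ k : cell '' K, ∃ x ∈ K, cell x = k.1 := fun k => k.2
  choose xk hxK hxcell using hpt
  have hnear : ∀ k : cell '' K, ∃ y ∈ E, dist (xk k) y < ε / 2 := fun k =>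
    Metric.mem_closure_iff.1 (hKE (hxK k)) _ (half_pos hε)
  choose yk hyE hyx using hnear
  set q : cell '' K → EuclideanSpace ℝ (Fin n) := fun k =>
    T (WithLp.toLp 2 fun i => if i = i₀ then T.symm (yk k) i₀ else ε * k.1 i) with hqdef
  have hq_coord : ∀ k, ∀ i ≠ i₀, T.symm (q k) i = ε * k.1 i := by
    intro k i hi
    simp [hqdef, hi]
  have hq_coord0 : ∀ k, T.symm (q k) i₀ = T.symm (yk k) i₀ := by
    intro k
    simp [hqdef]
  have hq0 : ∀ k, T.symm (q k - yk k) i₀ = 0 := by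
    intro k
    rw [map_sub, PiLp.sub_apply, hq_coord0, sub_self]
  have hxy : ∀ k i, |T.symm (xk k) i - T.symm (yk k) i| ≤ ε / 2 := by
    intro k i
    rw [← PiLp.sub_apply, ← map_sub]
    refine (abs_coord_le_norm _ i).trans ?_
    rw [T.symm.norm_map, ← dist_eq_norm]
    exact (hyx k).le
  have hqy : ∀ k, ∀ i ≠ i₀, |ε * k.1 i - T.symm (yk k) i| ≤ ε := by
    intro k i hi
    have h1 := hround (xk k) i hi
    rw [hxcell, abs_sub_comm] at h1
    have := abs_sub_le (ε * (k.1 i : ℝ)) (T.symm (xk k) i) (T.symm (yk k) i)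
    linarith [hxy k i]
  have hq : ∀ k i, |T.symm (q k - yk k) i| ≤ ε := by
    intro k i
    by_cases hi : i = i₀
    · rw [hi, hq0, abs_zero]; exact hε.le
    · rw [map_sub, PiLp.sub_apply, hq_coord k i hi]
      exact hqy k i hi
  choose ψ hψ hψc hψ01 hψ1 hψs hψD using fun k => hD (q k)
  have hcells := fun k => cell_estimate hp hΩm hf (hE _ (hyE k)) hε hr (hq k) (hq0 k) hδ0 hδ1
    (hψ k) (hψc k) (hψ01 k) (hψs k) hw.le hD0 (fun x => hψD k x w hw.le)
  have hballV : ∀ k, ball (yk k) (3 * n * ε) ⊆ V := by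
    intro k x hx
    refine hKV (mem_thickening_iff.2 ⟨xk k, hxK k, ?_⟩)
    have := dist_triangle x (yk k) (xk k)
    have h1 := hyx k
    rw [dist_comm] at h1
    rw [mem_ball] at hx
    linarith
  have hcone : ∀ y ∈ E, ∀ x ∈ K, |T.symm (x - y) i₀| ≤ 1 / (3 * n) * ‖x - y‖ := by
    intro y hy x hx
    have hcl : IsClosed {x | |T.symm (x - y) i₀| ≤ 1 / (3 * (n : ℝ)) * ‖x - y‖} :=
      isClosed_le (by fun_prop) (by fun_prop)
    refine closure_minimal (fun y' hy' => ?_) hcl (hKE hx)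
    have hL1 : 1 / (3 * (n : ℝ)) ≤ 1 := by
      rw [div_le_one (by positivity)]; linarith
    refine (hE y hy).abs_coord_sub_le hab hf (by positivity) hL1 hη (hE y' hy') ?_
    have h1 := mem_ball.1 (hEc hy)
    have h2 := mem_ball.1 (hEc hy')
    have := dist_triangle_right y' y c
    rw [← dist_eq_norm]
    linarith
  have hone : ∀ x ∈ K, ∃ k, ψ k x = 1 := by
    intro x hx
    refine ⟨⟨cell x, x, hx, rfl⟩, ?_⟩
    set k : cell '' K := ⟨cell x, x, hx, rfl⟩
    refine hψ1 k x fun i => ?_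
    by_cases hi : i = i₀
    · rw [hi, map_sub, PiLp.sub_apply, hq_coord0, ← PiLp.sub_apply, ← map_sub]
      refine abs_coord_le_of_cone hε.le (fun j hj => ?_) ?_
      · rw [map_sub, PiLp.sub_apply]
        have := abs_sub_le (T.symm x j) (ε * (cell x j : ℝ)) (T.symm (yk k) j)
        linarith [hround x j hj, hqy k j hj]
      · rw [T.symm.norm_map]
        exact hcone _ (hyE k) x hx
    · rw [map_sub, PiLp.sub_apply, hq_coord k i hi]
      exact hround x i hi
  have hcell0 : ∀ k : cell '' K, k.1 i₀ = 0 := by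
    intro k
    rw [← hxcell k]
    simp [hcell]
  have hcount : ∀ x, ∑ k, ψ k x ≤ 2 ^ n := by
    intro x
    refine sum_le_two_pow_of_lattice (fun i => if i = i₀ then 0 else T.symm x i / ε)
      (fun k => (hψ01 k x).2) fun k hk i => ?_
    by_cases hi : i = i₀
    · simp [hi, hcell0]
    · simp only [if_neg hi]
      have h1 := hψs k x hk i
      rw [map_sub, PiLp.sub_apply, hq_coord k i hi] at h1
      have e : T.symm x i / ε - k.1 i = (T.symm x i - ε * k.1 i) / ε := by field_simp
      rw [e, abs_div, abs_of_pos hε, div_lt_one hε]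
      nlinarith
  have hsum0 : ∀ x, 0 ≤ ∑ k, ψ k x := fun x => Finset.sum_nonneg fun k _ => (hψ01 k x).1
  have hInt : ∀ k, Integrable (fun x => ψ k x * ⟪w, σ x⟫) μ := by
    intro k
    have hm : AEStronglyMeasurable (fun x => ψ k x * ⟪w, σ x⟫) μ :=
      (hψ k).continuous.aestronglyMeasurable.mul (aestronglyMeasurable_const.inner hp.2.2.1)
    refine Integrable.of_bound hm 1 ?_
    filter_upwards [hp.2.2.2.1] with x hx
    have h1 := abs_real_inner_le_norm w (σ x)
    rw [hw, hx] at h1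
    rw [Real.norm_eq_abs, abs_mul, abs_of_nonneg (hψ01 k x).1]
    have := mul_le_mul (hψ01 k x).2 h1 (abs_nonneg _) zero_le_one
    linarith
  have hKm : MeasurableSet K := hK.measurableSet
  have hlower : (1 - δ) * μ.real K - 2 ^ n * μ.real (V \ K) ≤
      ∑ k, ∫ x, ψ k x * ⟪w, σ x⟫ ∂μ := by
    rw [← integral_finsetSum _ fun k _ => hInt k]
    have e : (1 - δ) * μ.real K - 2 ^ n * μ.real (V \ K) =
        ∫ x, (K.indicator (fun _ => 1 - δ) x - (V \ K).indicator (fun _ => (2 : ℝ) ^ n) x) ∂μ := by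
      rw [integral_sub ((integrable_const _).indicator hKm)
        ((integrable_const _).indicator (hV.diff hKm)), integral_indicator hKm,
        integral_indicator (hV.diff hKm), setIntegral_const, setIntegral_const, smul_eq_mul,
        smul_eq_mul]
      ring
    rw [e]
    refine integral_mono_ae (((integrable_const _).indicator hKm).sub
        ((integrable_const _).indicator (hV.diff hKm)))
      (integrable_finsetSum _ fun k _ => hInt k) ?_
    filter_upwards [hp.2.2.2.1] with x hx
    rw [← Finset.sum_mul]
    have h1 := abs_real_inner_le_norm w (σ x)
    rw [hw, hx, mul_one] at h1
    by_cases hxK' : x ∈ K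
    · rw [Set.indicator_of_mem hxK', Set.indicator_of_notMem (fun h => h.2 hxK'), sub_zero]
      have h2 : 1 - δ ≤ ⟪w, σ x⟫ := by
        have h3 : ⟪w, σ x⟫ = 1 + ⟪w, σ x - w⟫ := by
          rw [inner_sub_right, real_inner_self_eq_norm_sq, hw]; ring
        have h4 := abs_real_inner_le_norm w (σ x - w)
        rw [hw, one_mul] at h4
        linarith [(abs_le.1 h4).1, hσ x hxK']
      obtain ⟨k, hk⟩ := hone x hxK'
      have h5 : 1 ≤ ∑ k, ψ k x := by
        rw [← hk]
        exact Finset.single_le_sum (f := fun k => ψ k x) (fun j _ => (hψ01 j x).1)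
          (Finset.mem_univ k)
      nlinarith
    · rw [Set.indicator_of_notMem hxK', zero_sub]
      by_cases hxV : x ∈ V
      · rw [Set.indicator_of_mem (show x ∈ V \ K from ⟨hxV, hxK'⟩)]
        have := (abs_le.1 h1).1
        nlinarith [hcount x, hsum0 x]
      · rw [Set.indicator_of_notMem fun h => hxV h.1]
        have : ∑ k, ψ k x = 0 := Finset.sum_eq_zero fun k _ =>
          image_eq_zero_of_notMem_tsupport fun h => hxV (hballV k ((hcells k).2.1 h))
        rw [this]; simp
  have hupper : ∀ k, ∫ x, ψ k x * ⟪w, σ x⟫ ∂μ ≤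
      C * (1 - δ) * (ε ^ (n - 1) * meanOsc f (orientedCube T (q k) ε)) := by
    intro k
    obtain ⟨-, -, h1, h2⟩ := hcells k
    refine h2.trans ?_
    have hA : 0 ≤ |a - b| := abs_nonneg _
    have hεn : 0 ≤ ε ^ (n - 1) := by positivity
    have h3 : |a - b| * (1 - 2 * η * (3 * n) ^ n) ≤ 2 * meanOsc f (orientedCube T (q k) ε) := by
      linarith
    have h4 := mul_le_mul_of_nonneg_left hconst hA
    have h5 := mul_le_mul_of_nonneg_left h3 (mul_nonneg hC (sub_nonneg.2 hδ1.le))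
    have h6 : |a - b| * ((1 + δ) ^ (n - 1) + D * η * (3 * n) ^ n) ≤
        C * (1 - δ) * meanOsc f (orientedCube T (q k) ε) := by linarith
    have h7 := mul_le_mul_of_nonneg_left h6 hεn
    linarith
  have hosc0 : ∀ k, 0 ≤ meanOsc f (orientedCube T (q k) ε) := by
    intro k
    rw [meanOsc, setAverage_eq, smul_eq_mul]
    exact mul_nonneg (inv_nonneg.2 measureReal_nonneg) (integral_nonneg fun x => abs_nonneg _)
  have hkap : ENNReal.ofReal (∑ k, ε ^ (n - 1) * meanOsc f (orientedCube T (q k) ε)) ≤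
      kappa n ε f V := by
    refine le_trans (le_of_eq ?_) (tsum_meanOsc_le_kappa hε (fun k => orientedCube T (q k) ε)
      (fun k => isCube_orientedCube _ _ _) (fun k => (hcells k).1.trans (hballV k)) ?_)
    · rw [tsum_fintype, ENNReal.ofReal_sum_of_nonneg fun k _ =>
        mul_nonneg (by positivity) (hosc0 k)]
      exact Finset.sum_congr rfl fun k _ => ENNReal.ofReal_mul (by positivity)
    · intro k l hkl
      have : ∃ i, k.1 i ≠ l.1 i := by
        by_contra! h
        exact hkl (Subtype.ext (funext h))
      obtain ⟨i, hi⟩ := this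
      have hi0 : i ≠ i₀ := fun h => hi (by rw [h, hcell0, hcell0])
      refine disjoint_orientedCube (i := i) ?_
      rw [map_sub, PiLp.sub_apply, hq_coord k i hi0, hq_coord l i hi0, ← mul_sub, abs_mul,
        abs_of_pos hε]
      have : (1 : ℝ) ≤ |(k.1 i : ℝ) - l.1 i| := by
        exact_mod_cast Int.one_le_abs (sub_ne_zero.2 hi)
      nlinarith
  have hδ' : 0 < 1 - δ := sub_pos.2 hδ1
  have hreal : μ.real K ≤ C * (∑ k, ε ^ (n - 1) * meanOsc f (orientedCube T (q k) ε)) +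
      2 ^ n / (1 - δ) * μ.real (V \ K) := by
    have h1 := hlower.trans (Finset.sum_le_sum fun k _ => hupper k)
    rw [← Finset.mul_sum] at h1
    refine le_of_mul_le_mul_left ?_ hδ'
    rw [mul_add, ← mul_assoc (1 - δ) (_ / _), mul_div_cancel₀ _ hδ'.ne']
    linarith
  calc μ K = ENNReal.ofReal (μ.real K) := (ofReal_measureReal).symm
    _ ≤ ENNReal.ofReal (C * (∑ k, ε ^ (n - 1) * meanOsc f (orientedCube T (q k) ε)) +
      2 ^ n / (1 - δ) * μ.real (V \ K)) := ENNReal.ofReal_le_ofReal hreal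
    _ ≤ _ := by
      refine ENNReal.ofReal_add_le.trans (add_le_add ?_ (le_of_eq ?_))
      · rw [ENNReal.ofReal_mul hC]
        gcongr
      · rw [ENNReal.ofReal_mul (by positivity), ofReal_measureReal]

end Piece

section Good

variable {n : ℕ}

lemma kappa_mono {ε : ℝ} (hε : 0 < ε) (f : EuclideanSpace ℝ (Fin n) → ℝ)
    {U V : Set (EuclideanSpace ℝ (Fin n))} (h : U ⊆ V) : kappa n ε f U ≤ kappa n ε f V :=
  le_self_add.trans (kappa_add_le hε h (Set.empty_subset V) (Set.disjoint_empty U))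

/-- The measure of `K` is asymptotically bounded by `C` times the oscillation functional of any
neighbourhood of `K`. -/
def IsOscBounded (C : ℝ) (f : EuclideanSpace ℝ (Fin n) → ℝ) (Ω : Set (EuclideanSpace ℝ (Fin n)))
    (μ : Measure (EuclideanSpace ℝ (Fin n))) (K : Set (EuclideanSpace ℝ (Fin n))) : Prop :=
  ∀ U, IsOpen U → K ⊆ U → U ⊆ Ω → ∀ τ : ℝ≥0∞, τ ≠ 0 →
    ∀ᶠ ε in 𝓝[>] (0 : ℝ), μ K ≤ ENNReal.ofReal C * kappa n ε f U + τ

variable {f : EuclideanSpace ℝ (Fin n) → ℝ} {Ω : Set (EuclideanSpace ℝ (Fin n))}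
  {μ : Measure (EuclideanSpace ℝ (Fin n))} {C : ℝ}

lemma IsOscBounded.union {K K' : Set (EuclideanSpace ℝ (Fin n))}
    (h : IsOscBounded C f Ω μ K) (h' : IsOscBounded C f Ω μ K') (hK : IsCompact K)
    (hK' : IsCompact K') (hd : Disjoint K K') : IsOscBounded C f Ω μ (K ∪ K') := by
  intro U hU hKU hUΩ τ hτ
  obtain ⟨V, V', hV, hV', hKV, hKV', hVV'⟩ := SeparatedNhds.of_isCompact_isCompact hK hK' hd
  have hτ2 : τ / 2 ≠ 0 := by simpa using hτ
  filter_upwards [h (U ∩ V) (hU.inter hV) (Set.subset_inter (Set.subset_union_left.trans hKU) hKV)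
    (Set.inter_subset_left.trans hUΩ) _ hτ2,
    h' (U ∩ V') (hU.inter hV') (Set.subset_inter (Set.subset_union_right.trans hKU) hKV')
    (Set.inter_subset_left.trans hUΩ) _ hτ2, self_mem_nhdsWithin] with ε h1 h2 hε
  calc μ (K ∪ K') ≤ μ K + μ K' := measure_union_le _ _
    _ ≤ (ENNReal.ofReal C * kappa n ε f (U ∩ V) + τ / 2) +
        (ENNReal.ofReal C * kappa n ε f (U ∩ V') + τ / 2) := add_le_add h1 h2
    _ = ENNReal.ofReal C * (kappa n ε f (U ∩ V) + kappa n ε f (U ∩ V')) + (τ / 2 + τ / 2) := by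
      ring
    _ ≤ _ := by
      rw [ENNReal.add_halves]
      gcongr
      exact kappa_add_le hε Set.inter_subset_left Set.inter_subset_left
        (hVV'.mono Set.inter_subset_right Set.inter_subset_right)

lemma IsOscBounded.biUnion_finset {ι : Type*} (s : Finset ι)
    {K : ι → Set (EuclideanSpace ℝ (Fin n))} (h : ∀ i, IsOscBounded C f Ω μ (K i))
    (hK : ∀ i, IsCompact (K i)) (hd : Pairwise fun i j => Disjoint (K i) (K j)) :
    IsOscBounded C f Ω μ (⋃ i ∈ s, K i) := by
  induction s using Finset.induction_on with
  | empty =>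
    intro U _ _ _ τ _
    simp
  | insert i s hi ih =>
    rw [Finset.set_biUnion_insert]
    refine (h i).union ih (hK i) (s.isCompact_biUnion fun j _ => hK j) ?_
    rw [Set.disjoint_iUnion₂_right]
    exact fun j hj => hd fun hij => hi (hij ▸ hj)

lemma IsOscBounded.measure_le {K : Set (EuclideanSpace ℝ (Fin n))}
    (h : IsOscBounded C f Ω μ K) (hΩ : IsOpen Ω) (hK : K ⊆ Ω) (hC : 0 < C) :
    μ K ≤ ENNReal.ofReal C * liminf (fun ε => kappa n ε f Ω) (𝓝[>] (0 : ℝ)) := by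
  have hC0 : ENNReal.ofReal C ≠ 0 := by simpa using hC
  refine ENNReal.le_of_forall_pos_le_add fun τ hτ _ => ?_
  have h1 := h Ω hΩ hK subset_rfl τ (by simpa using hτ.ne')
  have h2 : (μ K - τ) / ENNReal.ofReal C ≤ liminf (fun ε => kappa n ε f Ω) (𝓝[>] (0 : ℝ)) := by
    refine le_liminf_of_le (by isBoundedDefault) (h1.mono fun ε hε => ?_)
    refine ENNReal.div_le_of_le_mul ?_
    rw [mul_comm]
    exact tsub_le_iff_right.2 hε
  rw [← tsub_le_iff_right, mul_comm]
  exact (ENNReal.div_le_iff_le_mul (Or.inl hC0) (Or.inl ENNReal.ofReal_ne_top)).1 h2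

lemma exists_isOscBounded_of_isNearJump (i₀ : Fin n) (hC : 2 < C) :
    ∃ δ > 0, ∃ η > 0, ∀ (f : EuclideanSpace ℝ (Fin n) → ℝ) (Ω : Set (EuclideanSpace ℝ (Fin n)))
      (μ : Measure (EuclideanSpace ℝ (Fin n)))
      (σ : EuclideanSpace ℝ (Fin n) → EuclideanSpace ℝ (Fin n)),
      IsVariationPair n f Ω μ σ → IsOpen Ω → LocallyIntegrableOn f Ω →
      ∀ (T : EuclideanSpace ℝ (Fin n) ≃ₗᵢ[ℝ] EuclideanSpace ℝ (Fin n)) (a b r : ℝ)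
        (E K : Set (EuclideanSpace ℝ (Fin n))) (c w : EuclideanSpace ℝ (Fin n)),
        a ≠ b → 0 < r → (∀ y ∈ E, IsNearJump T i₀ a b η r f Ω y) → E ⊆ ball c (r / 4) →
        IsCompact K → K ⊆ closure E → ‖w‖ = 1 → (∀ x ∈ K, ‖σ x - w‖ ≤ δ) →
        IsOscBounded C f Ω μ K := by
  have hn' : (0 : ℝ) < n := by exact_mod_cast i₀.pos
  obtain ⟨δ, hδ, hδ0, hδ1⟩ : ∃ δ : ℝ, 2 * (1 + δ) ^ (n - 1) < C * (1 - δ) ∧ 0 < δ ∧ δ < 1 := by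
    have h1 : ∀ᶠ δ in 𝓝 (0 : ℝ), 2 * (1 + δ) ^ (n - 1) < C * (1 - δ) := by
      refine ContinuousAt.eventually_lt (by fun_prop) (by fun_prop) ?_
      simpa using hC
    have h2 : ∀ᶠ δ in 𝓝[>] (0 : ℝ), 0 < δ ∧ δ < 1 := Ioo_mem_nhdsGT one_pos
    exact ((h1.filter_mono nhdsWithin_le_nhds).and h2).exists
  obtain ⟨D, hD0, hD⟩ := exists_cutoff_orientedCube n hδ0
  obtain ⟨η, ⟨hη1, hη2⟩, hη0⟩ : ∃ η : ℝ, (2 * ((1 + δ) ^ (n - 1) + D * η * (3 * n) ^ n) <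
      C * (1 - δ) * (1 - 2 * η * (3 * n) ^ n) ∧ η * (2 ^ n + (1 / (3 * n)) ^ n) <
      (1 / (3 * n) / 2 : ℝ) ^ n * volume.real (ball (0 : EuclideanSpace ℝ (Fin n)) 1)) ∧
      0 < η := by
    have h1 : ∀ᶠ η in 𝓝 (0 : ℝ), 2 * ((1 + δ) ^ (n - 1) + D * η * (3 * n) ^ n) <
        C * (1 - δ) * (1 - 2 * η * (3 * n) ^ n) := by
      refine ContinuousAt.eventually_lt (by fun_prop) (by fun_prop) ?_
      simpa using hδ
    have h2 : ∀ᶠ η in 𝓝 (0 : ℝ), η * (2 ^ n + (1 / (3 * n)) ^ n) <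
        (1 / (3 * n) / 2 : ℝ) ^ n * volume.real (ball (0 : EuclideanSpace ℝ (Fin n)) 1) := by
      refine ContinuousAt.eventually_lt (by fun_prop) (by fun_prop) ?_
      rw [zero_mul]
      have : 0 < volume.real (ball (0 : EuclideanSpace ℝ (Fin n)) 1) :=
        ENNReal.toReal_pos (measure_ball_pos _ _ one_pos).ne' measure_ball_ne_top
      positivity
    exact (((h1.and h2).filter_mono nhdsWithin_le_nhds).and
      (self_mem_nhdsWithin : Set.Ioi (0 : ℝ) ∈ 𝓝[>] 0)).exists
  refine ⟨δ, hδ0, η, hη0, fun f Ω μ σ hp hΩ hf T a b r E K c w hab hr hE hEc hK hKE hw hσ => ?_⟩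
  intro U hU hKU hUΩ τ hτ
  have := hp.1
  set M := ENNReal.ofReal (2 ^ n / (1 - δ)) with hM
  have hτM : τ / M ≠ 0 := by
    simp [hτ, hM]
  obtain ⟨U', hKU', hU', hμ⟩ := hK.exists_isOpen_lt_add (μ := μ) hτM
  obtain ⟨ρ, hρ, hρU⟩ := hK.exists_thickening_subset_open (hU.inter hU')
    (Set.subset_inter hKU hKU')
  have hdiff : M * μ ((U ∩ U') \ K) ≤ τ := by
    have h1 : μ ((U ∩ U') \ K) ≤ τ / M := by
      refine (measure_mono (Set.sdiff_subset_sdiff_left Set.inter_subset_right)).trans ?_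
      rw [measure_sdiff hKU' hK.measurableSet.nullMeasurableSet (measure_ne_top _ _)]
      exact tsub_le_iff_left.2 hμ.le
    exact (mul_le_mul_right h1 M).trans ENNReal.mul_div_le
  have hε0 : 0 < min r ρ / (3 * n + 1) := by positivity
  filter_upwards [Ioo_mem_nhdsGT hε0] with ε hε
  have hε1 : (3 * n + 1) * ε < min r ρ := by
    rw [mul_comm, ← lt_div_iff₀ (by positivity)]
    exact hε.2
  have h := measure_le_kappa_of_isNearJump hp hΩ.measurableSet hf hab hE hEc hK hKE hw hσ hδ0 hδ1
    hη2 (by linarith) hD0 (fun q => hD T q ε hε.1) hη1.le hε.1 (V := U ∩ U')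
    (by linarith [min_le_left r ρ, hε.1]) (hU.inter hU').measurableSet
    ((thickening_mono (hε1.le.trans (min_le_right _ _)) K).trans hρU)
  refine h.trans (add_le_add ?_ hdiff)
  gcongr
  exact kappa_mono hε.1 f Set.inter_subset_left

end Good

section Blowup

variable {n : ℕ}

lemma exists_frame (i₀ : Fin n) {ν : EuclideanSpace ℝ (Fin n)} (hν : ‖ν‖ = 1) :
    ∃ T : EuclideanSpace ℝ (Fin n) ≃ₗᵢ[ℝ] EuclideanSpace ℝ (Fin n),
      ∀ y, T.symm y i₀ = ⟪y, ν⟫ := by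
  set e : EuclideanSpace ℝ (Fin n) := EuclideanSpace.single i₀ 1 with he
  have hT : ∃ T : EuclideanSpace ℝ (Fin n) ≃ₗᵢ[ℝ] EuclideanSpace ℝ (Fin n), T e = ν :=
    ⟨(ℝ ∙ (e - ν))ᗮ.reflection, Submodule.reflection_sub (by simp [he, hν])⟩
  obtain ⟨T, hT⟩ := hT
  refine ⟨T, fun y => ?_⟩
  calc T.symm y i₀ = ⟪T.symm y, e⟫ := by simp [he, EuclideanSpace.inner_single_right]
    _ = ⟪T (T.symm y), T e⟫ := (T.inner_map_map _ _).symm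
    _ = ⟪y, ν⟫ := by rw [T.apply_symm_apply, hT]

variable {f : EuclideanSpace ℝ (Fin n) → ℝ} {Ω : Set (EuclideanSpace ℝ (Fin n))}

lemma volume_real_ball (x : EuclideanSpace ℝ (Fin n)) {ρ : ℝ} (hρ : 0 < ρ) :
    volume.real (ball x ρ) = ρ ^ n * volume.real (ball (0 : EuclideanSpace ℝ (Fin n)) 1) := by
  rw [Measure.real, Measure.addHaar_ball_of_pos _ _ hρ, ENNReal.toReal_mul,
    finrank_euclideanSpace_fin, ENNReal.toReal_ofReal (by positivity), Measure.real]

lemma tendsto_setIntegral_jump_div (hΩ : IsOpen Ω) (hf : LocallyIntegrableOn f Ω)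
    {x : EuclideanSpace ℝ (Fin n)} (hx : x ∈ Ω)
    {T : EuclideanSpace ℝ (Fin n) ≃ₗᵢ[ℝ] EuclideanSpace ℝ (Fin n)} {i₀ : Fin n} {a b : ℝ}
    (ha : Tendsto (fun r : ℝ => ⨍ y in ball x r ∩ {y | 0 < T.symm (y - x) i₀}, |f y - a|)
      (𝓝[>] 0) (𝓝 0))
    (hb : Tendsto (fun r : ℝ => ⨍ y in ball x r ∩ {y | T.symm (y - x) i₀ < 0}, |f y - b|)
      (𝓝[>] 0) (𝓝 0)) :
    Tendsto (fun ρ : ℝ =>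
      (∫ y in ball x ρ, |f y - stepFun (fun y => T.symm (y - x) i₀) a b y|) / ρ ^ n)
      (𝓝[>] 0) (𝓝 0) := by
  set φ : EuclideanSpace ℝ (Fin n) → ℝ := fun y => T.symm (y - x) i₀ with hφ
  have hφm : Measurable φ := measurable_coord T x i₀
  set ω := volume.real (ball (0 : EuclideanSpace ℝ (Fin n)) 1)
  have hlim := (ha.add hb).const_mul ω
  rw [add_zero, mul_zero] at hlim
  obtain ⟨R, hR, hRΩ⟩ := Metric.isOpen_iff.1 hΩ x hx
  refine tendsto_of_tendsto_of_tendsto_of_le_of_le' tendsto_const_nhds hlim ?_ ?_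
  · filter_upwards [self_mem_nhdsWithin] with ρ hρ
    have : (0 : ℝ) < ρ := hρ
    exact div_nonneg (integral_nonneg fun y => abs_nonneg _) (by positivity)
  · filter_upwards [Ioo_mem_nhdsGT hR] with ρ hρ
    have hρ0 : 0 < ρ := hρ.1
    have hP : MeasurableSet {y | 0 < φ y} := measurableSet_lt measurable_const hφm
    have hN : MeasurableSet {y | φ y < 0} := measurableSet_lt hφm measurable_const
    have hfi : IntegrableOn f (ball x ρ) :=
      (hf.integrableOn_compact_subset ((closedBall_subset_ball hρ.2).trans hRΩ)
        (isCompact_closedBall x ρ)).mono_set ball_subset_closedBall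
    have hgi : IntegrableOn (fun y => |f y - stepFun φ a b y|) (ball x ρ) :=
      (hfi.sub (integrableOn_stepFun hφm a b measure_ball_ne_top)).abs
    have hae : (ball x ρ \ {y | 0 < φ y} : Set _) =ᵐ[volume] (ball x ρ ∩ {y | φ y < 0} : Set _) := by
      have h0 : ∀ᵐ y, φ y ≠ 0 := by
        rw [ae_iff]
        simp only [ne_eq, not_not]
        exact volume_coord_eq T x i₀ 0
      filter_upwards [h0] with y hy
      refine propext (and_congr_right fun _ => ?_)
      change ¬ (0 < φ y) ↔ φ y < 0
      rw [not_lt]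
      exact ⟨fun h => lt_of_le_of_ne h hy, le_of_lt⟩
    have e1 : ∫ y in ball x ρ ∩ {y | 0 < φ y}, |f y - stepFun φ a b y| =
        volume.real (ball x ρ ∩ {y | 0 < φ y}) *
          ⨍ y in ball x ρ ∩ {y | 0 < φ y}, |f y - a| := by
      rw [← smul_eq_mul, measure_smul_setAverage _
        ((measure_mono Set.inter_subset_left).trans_lt measure_ball_lt_top).ne]
      refine setIntegral_congr_fun (measurableSet_ball.inter hP) fun y hy => ?_
      have : 0 < φ y := hy.2
      simp only [stepFun, if_pos this]
    have e2 : ∫ y in ball x ρ ∩ {y | φ y < 0}, |f y - stepFun φ a b y| =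
        volume.real (ball x ρ ∩ {y | φ y < 0}) *
          ⨍ y in ball x ρ ∩ {y | φ y < 0}, |f y - b| := by
      rw [← smul_eq_mul, measure_smul_setAverage _
        ((measure_mono Set.inter_subset_left).trans_lt measure_ball_lt_top).ne]
      refine setIntegral_congr_fun (measurableSet_ball.inter hN) fun y hy => ?_
      have : φ y < 0 := hy.2
      simp only [stepFun, if_neg this.not_gt]
    have hvol : ∀ H : Set (EuclideanSpace ℝ (Fin n)), volume.real (ball x ρ ∩ H) ≤ ρ ^ n * ω := by
      intro H
      rw [← volume_real_ball x hρ0]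
      exact measureReal_mono Set.inter_subset_left measure_ball_ne_top
    have havg : ∀ (H : Set (EuclideanSpace ℝ (Fin n))) (t : ℝ), 0 ≤ ⨍ y in H, |f y - t| := by
      intro H t
      rw [setAverage_eq, smul_eq_mul]
      exact mul_nonneg (inv_nonneg.2 measureReal_nonneg) (integral_nonneg fun x => abs_nonneg _)
    rw [← integral_inter_add_sdiff hP hgi, setIntegral_congr_set hae, e1, e2,
      div_le_iff₀ (by positivity)]
    have h1 := mul_le_mul_of_nonneg_right (hvol {y | 0 < φ y})
      (havg (ball x ρ ∩ {y | 0 < φ y}) a)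
    have h2 := mul_le_mul_of_nonneg_right (hvol {y | φ y < 0})
      (havg (ball x ρ ∩ {y | φ y < 0}) b)
    linarith

lemma setIntegral_ball_stepFun_sub (x ν ν' : EuclideanSpace ℝ (Fin n)) (a b a' b' : ℝ) {ρ : ℝ}
    (hρ : 0 < ρ) :
    ∫ y in ball x ρ, |stepFun (fun y => ⟪y - x, ν⟫) a b y - stepFun (fun y => ⟪y - x, ν'⟫) a' b' y| =
      ρ ^ n * ∫ z in ball 0 1, |stepFun (fun z => ⟪z, ν⟫) a b z - stepFun (fun z => ⟪z, ν'⟫) a' b' z| := by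
  set g : EuclideanSpace ℝ (Fin n) → ℝ := fun z =>
    |stepFun (fun z => ⟪z, ν⟫) a b z - stepFun (fun z => ⟪z, ν'⟫) a' b' z| with hg
  have h1 : ∫ y in ball x ρ, g (y - x) = ∫ z in ball 0 ρ, g z := by
    have := (measurePreserving_sub_right (volume : Measure (EuclideanSpace ℝ (Fin n))) x)
      |>.setIntegral_preimage_emb (measurableEmbedding_subRight x) g (ball 0 ρ)
    rw [← this]
    congr 2
    ext y
    simp [dist_eq_norm]
  have h2 : ∀ z, g (ρ • z) = g z := by
    intro z
    simp only [hg, stepFun, real_inner_smul_left, mul_pos_iff_of_pos_left hρ]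
  have h3 := Measure.setIntegral_comp_smul_of_pos (volume : Measure (EuclideanSpace ℝ (Fin n))) g
    (ball 0 1) hρ
  simp only [h2, finrank_euclideanSpace_fin, smul_eq_mul] at h3
  rw [smul_unitBall_of_pos hρ] at h3
  change ∫ y in ball x ρ, g (y - x) = _
  rw [h1, h3]
  field_simp

lemma tendsto_setIntegral_stepFun_sub {ν : EuclideanSpace ℝ (Fin n)} (hν : ‖ν‖ = 1)
    (i₀ : Fin n) (a b : ℝ) :
    Tendsto (fun p : ℝ × ℝ × EuclideanSpace ℝ (Fin n) =>
      ∫ z in ball 0 1, |stepFun (fun z => ⟪z, ν⟫) a b z - stepFun (fun z => ⟪z, p.2.2⟫) p.1 p.2.1 z|)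
      (𝓝 (a, b, ν)) (𝓝 0) := by
  have h0 : ∫ z : EuclideanSpace ℝ (Fin n) in ball 0 1, (0 : ℝ) = 0 := by simp
  rw [← h0]
  have hm : ∀ (ν : EuclideanSpace ℝ (Fin n)) (a b : ℝ), Measurable (stepFun (fun z => ⟪z, ν⟫) a b) :=
    fun ν a b => measurable_stepFun (by fun_prop : Continuous fun z => ⟪z, ν⟫).measurable a b
  refine tendsto_integral_filter_of_dominated_convergence
    (fun _ => |a| + |b| + ((|a| + 1) + (|b| + 1))) ?_ ?_ (integrableOn_const measure_ball_ne_top) ?_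
  · exact Eventually.of_forall fun p => ((hm ν a b).sub (hm _ _ _)).abs.aestronglyMeasurable
  · have h1 : ∀ᶠ p : ℝ × ℝ × EuclideanSpace ℝ (Fin n) in 𝓝 (a, b, ν), |p.1| < |a| + 1 :=
      ContinuousAt.eventually_lt (by fun_prop) (by fun_prop) (by simp)
    have h2 : ∀ᶠ p : ℝ × ℝ × EuclideanSpace ℝ (Fin n) in 𝓝 (a, b, ν), |p.2.1| < |b| + 1 :=
      ContinuousAt.eventually_lt (by fun_prop) (by fun_prop) (by simp)
    filter_upwards [h1, h2] with p hp1 hp2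
    refine Eventually.of_forall fun z => ?_
    rw [norm_abs_eq_norm]
    refine (norm_sub_le _ _).trans (add_le_add (norm_stepFun_le _ _ _ _)
      ((norm_stepFun_le _ _ _ _).trans (add_le_add hp1.le hp2.le)))
  · obtain ⟨T, hT⟩ := exists_frame i₀ hν
    have h1 : ∀ᵐ z : EuclideanSpace ℝ (Fin n), ⟪z, ν⟫ ≠ 0 := by
      rw [ae_iff]
      simpa [hT] using volume_coord_eq T 0 i₀ 0
    filter_upwards [ae_restrict_of_ae h1] with z hz
    rcases lt_or_gt_of_ne hz with h | h
    · have h2 : ∀ᶠ p : ℝ × ℝ × EuclideanSpace ℝ (Fin n) in 𝓝 (a, b, ν), ⟪z, p.2.2⟫ < 0 :=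
        ContinuousAt.eventually_lt (by fun_prop) (by fun_prop) h
      have h3 : Tendsto (fun p : ℝ × ℝ × EuclideanSpace ℝ (Fin n) => |b - p.2.1|) (𝓝 (a, b, ν))
          (𝓝 |b - b|) := (by fun_prop : Continuous
            fun p : ℝ × ℝ × EuclideanSpace ℝ (Fin n) => |b - p.2.1|).tendsto _
      rw [sub_self, abs_zero] at h3
      refine h3.congr' (h2.mono fun p hp => ?_)
      simp only [stepFun, if_neg h.not_gt, if_neg hp.not_gt]
    · have h2 : ∀ᶠ p : ℝ × ℝ × EuclideanSpace ℝ (Fin n) in 𝓝 (a, b, ν), 0 < ⟪z, p.2.2⟫ :=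
        ContinuousAt.eventually_lt (by fun_prop) (by fun_prop) h
      have h3 : Tendsto (fun p : ℝ × ℝ × EuclideanSpace ℝ (Fin n) => |a - p.1|) (𝓝 (a, b, ν))
          (𝓝 |a - a|) := (by fun_prop : Continuous
            fun p : ℝ × ℝ × EuclideanSpace ℝ (Fin n) => |a - p.1|).tendsto _
      rw [sub_self, abs_zero] at h3
      refine h3.congr' (h2.mono fun p hp => ?_)
      simp only [stepFun, if_pos h, if_pos hp]

end Blowup

section Covering

variable {n : ℕ} {f : EuclideanSpace ℝ (Fin n) → ℝ} {Ω : Set (EuclideanSpace ℝ (Fin n))}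
  {μ : Measure (EuclideanSpace ℝ (Fin n))}
  {σ : EuclideanSpace ℝ (Fin n) → EuclideanSpace ℝ (Fin n)}

lemma eventually_isNearJump (hΩ : IsOpen Ω) (hf : LocallyIntegrableOn f Ω) {i₀ : Fin n}
    {T : EuclideanSpace ℝ (Fin n) → EuclideanSpace ℝ (Fin n) ≃ₗᵢ[ℝ] EuclideanSpace ℝ (Fin n)}
    (hT : ∀ ν, ‖ν‖ = 1 → ∀ y, (T ν).symm y i₀ = ⟪y, ν⟫) {η : ℝ} (hη : 0 < η)
    {x : EuclideanSpace ℝ (Fin n)} (hx : x ∈ jumpSet n f ∩ Ω) :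
    ∃ p : ℝ × ℝ × EuclideanSpace ℝ (Fin n), ‖p.2.2‖ = 1 ∧ ∀ᶠ p' in 𝓝 p, ‖p'.2.2‖ = 1 →
      p'.1 ≠ p'.2.1 ∧ ∃ m : ℕ, IsNearJump (T p'.2.2) i₀ p'.1 p'.2.1 η (1 / (m + 1)) f Ω x := by
  obtain ⟨⟨ν, hν, a, b, hab, ha, hb⟩, hxΩ⟩ := hx
  refine ⟨(a, b, ν), hν, ?_⟩
  have hA : 0 < |a - b| := abs_pos.2 (sub_ne_zero.2 hab)
  have h1 := (tendsto_setIntegral_stepFun_sub hν i₀ a b).eventually_lt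
    (g := fun p : ℝ × ℝ × EuclideanSpace ℝ (Fin n) => η * |p.1 - p.2.1| / 2)
    ((by fun_prop : Continuous fun p : ℝ × ℝ × EuclideanSpace ℝ (Fin n) =>
      η * |p.1 - p.2.1| / 2).tendsto _) (by positivity)
  have h2 : ∀ᶠ p : ℝ × ℝ × EuclideanSpace ℝ (Fin n) in 𝓝 (a, b, ν), 0 < |p.1 - p.2.1| :=
    ContinuousAt.eventually_lt (by fun_prop) (by fun_prop) hA
  filter_upwards [h1, h2] with p hp1 hp2 hpν
  refine ⟨sub_ne_zero.1 (abs_pos.1 hp2), ?_⟩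
  simp only [← hT ν hν] at ha hb
  have h3 := (tendsto_setIntegral_jump_div hΩ hf hxΩ ha hb).eventually_lt_const
    (u := η * |p.1 - p.2.1| / 2) (by positivity)
  obtain ⟨r, hr, hr'⟩ := mem_nhdsGT_iff_exists_Ioo_subset.1 h3
  obtain ⟨R, hR, hRΩ⟩ := Metric.isOpen_iff.1 hΩ x hxΩ
  obtain ⟨m, hm⟩ := exists_nat_one_div_lt (lt_min hr hR)
  have hball : closedBall x (1 / (m + 1)) ⊆ Ω :=
    (closedBall_subset_ball (hm.trans_le (min_le_right _ _))).trans hRΩ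
  refine ⟨m, hball, fun ρ hρ => ?_⟩
  have hρn : 0 < ρ ^ n := pow_pos hρ.1 n
  have h4 : (∫ y in ball x ρ, |f y - stepFun (fun y => (T ν).symm (y - x) i₀) a b y|) / ρ ^ n <
      η * |p.1 - p.2.1| / 2 := hr' ⟨hρ.1, hρ.2.trans (hm.trans_le (min_le_left _ _))⟩
  rw [div_lt_iff₀ hρn] at h4
  have h5 := setIntegral_ball_stepFun_sub x ν p.2.2 a b p.1 p.2.1 hρ.1
  simp only [← hT ν hν, ← hT _ hpν] at h5 hp1
  have hfi : IntegrableOn f (ball x ρ) :=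
    (hf.integrableOn_compact_subset ((closedBall_subset_closedBall hρ.2.le).trans hball)
      (isCompact_closedBall x ρ)).mono_set ball_subset_closedBall
  have hi1 := integrableOn_stepFun (measurable_coord (T ν) x i₀) a b
    (measure_ball_ne_top (μ := volume) (x := x) (r := ρ))
  have hi2 := integrableOn_stepFun (measurable_coord (T p.2.2) x i₀) p.1 p.2.1
    (measure_ball_ne_top (μ := volume) (x := x) (r := ρ))
  calc _ ≤ ∫ y in ball x ρ, (|f y - stepFun (fun y => (T ν).symm (y - x) i₀) a b y| +
        |stepFun (fun y => (T ν).symm (y - x) i₀) a b y -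
          stepFun (fun y => (T p.2.2).symm (y - x) i₀) p.1 p.2.1 y|) :=
        integral_mono (hfi.sub hi2).abs ((hfi.sub hi1).abs.add (hi1.sub hi2).abs)
          fun y => abs_sub_le _ _ _
    _ = _ := integral_add (hfi.sub hi1).abs (hi1.sub hi2).abs
    _ ≤ _ := by
      rw [h5]
      have := mul_le_mul_of_nonneg_left hp1.le hρn.le
      linarith

lemma IsVariationPair.exists_measurable (hp : IsVariationPair n f Ω μ σ) :
    ∃ σ', Measurable σ' ∧ IsVariationPair n f Ω μ σ' := by
  obtain ⟨h1, h2, h3, h4, h5⟩ := hp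
  refine ⟨h3.mk σ, h3.stronglyMeasurable_mk.measurable, h1, h2,
    h3.stronglyMeasurable_mk.aestronglyMeasurable, ?_, fun Φ hΦ hc hs => ?_⟩
  · filter_upwards [h4, h3.ae_eq_mk] with x hx hx'
    rwa [← hx']
  · rw [h5 Φ hΦ hc hs]
    congr 1
    refine integral_congr_ae ?_
    filter_upwards [h3.ae_eq_mk] with x hx
    rw [hx]

lemma measure_le_of_iUnion_isOscBounded [IsFiniteMeasure μ] {C : ℝ} (hC : 0 < C) (hΩ : IsOpen Ω)
    {P : ℕ → Set (EuclideanSpace ℝ (Fin n))} (hP : ∀ k, MeasurableSet (P k))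
    (hPΩ : ∀ k, P k ⊆ Ω) (h : ∀ k K, IsCompact K → K ⊆ P k → IsOscBounded C f Ω μ K) :
    μ (⋃ k, P k) ≤ ENNReal.ofReal C * liminf (fun ε => kappa n ε f Ω) (𝓝[>] (0 : ℝ)) := by
  have hdm : ∀ k, MeasurableSet (disjointed P k) := fun k => MeasurableSet.disjointed hP k
  rw [← iUnion_disjointed, measure_iUnion (disjoint_disjointed P) hdm, ENNReal.tsum_eq_iSup_sum]
  refine iSup_le fun s => ENNReal.le_of_forall_pos_le_add fun τ hτ _ => ?_
  obtain ⟨τ', hτ'0, hτ'⟩ := ENNReal.exists_pos_sum_of_countable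
    (ENNReal.coe_ne_zero.2 hτ.ne') ℕ
  choose K hKP hK hKμ using fun k => (hdm k).exists_isCompact_lt_add (measure_ne_top μ _)
    (ENNReal.coe_ne_zero.2 (hτ'0 k).ne')
  have hd : Pairwise fun i j => Disjoint (K i) (K j) := fun i j hij =>
    (disjoint_disjointed P hij).mono (hKP i) (hKP j)
  have hgood := IsOscBounded.biUnion_finset s
    (fun k => h k (K k) (hK k) ((hKP k).trans (disjointed_subset P k))) hK hd
  have hle := hgood.measure_le hΩ
    (Set.iUnion₂_subset fun k _ => ((hKP k).trans (disjointed_subset P k)).trans (hPΩ k)) hC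
  rw [measure_biUnion_finset (fun i _ j _ hij => hd hij) fun k _ => (hK k).measurableSet] at hle
  calc ∑ k ∈ s, μ (disjointed P k) ≤ ∑ k ∈ s, (μ (K k) + τ' k) :=
        Finset.sum_le_sum fun k _ => (hKμ k).le
    _ = ∑ k ∈ s, μ (K k) + ∑ k ∈ s, (τ' k : ℝ≥0∞) := Finset.sum_add_distrib
    _ ≤ _ := add_le_add hle ((ENNReal.sum_le_tsum s).trans hτ'.le)

lemma measure_jumpSet_le_of_two_lt (i₀ : Fin n) {C : ℝ} (hC : 2 < C) (hΩ : IsOpen Ω)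
    (hf : LocallyIntegrableOn f Ω) (hp : IsVariationPair n f Ω μ σ) :
    μ (jumpSet n f ∩ Ω) ≤
      ENNReal.ofReal C * liminf (fun ε => kappa n ε f Ω) (𝓝[>] (0 : ℝ)) := by
  obtain ⟨σ, hσm, hp⟩ := hp.exists_measurable
  have := hp.1
  obtain ⟨δ, hδ, η, hη, hosc⟩ := exists_isOscBounded_of_isNearJump i₀ hC
  have hTex : ∀ ν : EuclideanSpace ℝ (Fin n),
      ∃ T : EuclideanSpace ℝ (Fin n) ≃ₗᵢ[ℝ] EuclideanSpace ℝ (Fin n),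
      ‖ν‖ = 1 → ∀ y, T.symm y i₀ = ⟪y, ν⟫ := by
    intro ν
    by_cases hν : ‖ν‖ = 1
    · obtain ⟨T, hT⟩ := exists_frame i₀ hν
      exact ⟨T, fun _ => hT⟩
    · exact ⟨LinearIsometryEquiv.refl ℝ _, fun h => absurd h hν⟩
  choose T hT using hTex
  have : Nonempty (sphere (0 : EuclideanSpace ℝ (Fin n)) 1) :=
    ⟨EuclideanSpace.single i₀ 1, by simp⟩
  set d := TopologicalSpace.denseSeq (ℝ × ℝ × sphere (0 : EuclideanSpace ℝ (Fin n)) 1)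
  have hd := TopologicalSpace.denseRange_denseSeq
    (ℝ × ℝ × sphere (0 : EuclideanSpace ℝ (Fin n)) 1)
  set c := TopologicalSpace.denseSeq (EuclideanSpace ℝ (Fin n))
  have hc := TopologicalSpace.denseRange_denseSeq (EuclideanSpace ℝ (Fin n))
  set w := TopologicalSpace.denseSeq (sphere (0 : EuclideanSpace ℝ (Fin n)) 1)
  have hw := TopologicalSpace.denseRange_denseSeq (sphere (0 : EuclideanSpace ℝ (Fin n)) 1)
  set E : ℕ × ℕ × ℕ × ℕ → Set (EuclideanSpace ℝ (Fin n)) := fun k =>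
    {y | (d k.1).1 ≠ (d k.1).2.1 ∧ IsNearJump (T (d k.1).2.2) i₀ (d k.1).1 (d k.1).2.1 η
      (1 / ((k.2.1 : ℝ) + 1)) f Ω y} ∩ ball (c k.2.2.1) (1 / ((k.2.1 : ℝ) + 1) / 4) with hE
  set P : ℕ × ℕ × ℕ × ℕ → Set (EuclideanSpace ℝ (Fin n)) := fun k =>
    closure (E k) ∩ {x | dist (σ x) (w k.2.2.2) < δ} ∩ Ω with hP
  have hPm : ∀ k, MeasurableSet (P k) := fun k =>
    (isClosed_closure.measurableSet.inter (measurableSet_lt (hσm.dist measurable_const)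
      measurable_const)).inter hΩ.measurableSet
  have hPosc : ∀ k K, IsCompact K → K ⊆ P k → IsOscBounded C f Ω μ K := by
    intro k K hK hKP
    by_cases hne : (d k.1).1 = (d k.1).2.1
    · have hK0 : K = ∅ := by
        refine Set.subset_empty_iff.1 fun x hx => ?_
        have hEk : E k = ∅ := by
          refine Set.subset_empty_iff.1 fun y hy => hy.1.1 hne
        have := (hKP hx).1.1
        rw [hEk, closure_empty] at this
        exact this
      intro U _ _ _ τ _
      simp [hK0]
    · refine hosc f Ω μ σ hp hΩ hf (T (d k.1).2.2) (d k.1).1 (d k.1).2.1 (1 / ((k.2.1 : ℝ) + 1))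
        (E k) K (c k.2.2.1) (w k.2.2.2) hne (by positivity) (fun y hy => hy.1.2)
        Set.inter_subset_right hK (fun x hx => (hKP hx).1.1) (by simp) fun x hx => ?_
      rw [← dist_eq_norm]
      exact le_of_lt (hKP hx).1.2
  have hcover : jumpSet n f ∩ Ω ∩ {x | ‖σ x‖ = 1} ⊆ ⋃ k, P k := by
    rintro x ⟨hx, hσx⟩
    obtain ⟨⟨a, b, ν⟩, hν, hev⟩ := eventually_isNearJump hΩ hf hT hη hx
    set p : ℝ × ℝ × sphere (0 : EuclideanSpace ℝ (Fin n)) 1 := (a, b, ⟨ν, by simpa using hν⟩)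
    have hcont : Tendsto (fun p : ℝ × ℝ × sphere (0 : EuclideanSpace ℝ (Fin n)) 1 =>
        (p.1, p.2.1, (p.2.2 : EuclideanSpace ℝ (Fin n)))) (𝓝 p) (𝓝 (a, b, ν)) :=
      Continuous.tendsto (by fun_prop) p
    obtain ⟨k₁, hk₁⟩ := hd.mem_nhds (hcont.eventually hev)
    obtain ⟨hne, m, hm⟩ := hk₁ (by simp)
    obtain ⟨k₃, hk₃⟩ := hc.exists_dist_lt x
      (by positivity : (0 : ℝ) < 1 / ((m : ℝ) + 1) / 4)
    obtain ⟨k₄, hk₄⟩ := hw.exists_dist_lt ⟨σ x, by simpa using hσx⟩ hδ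
    refine Set.mem_iUnion.2 ⟨(k₁, m, k₃, k₄), ⟨subset_closure ⟨⟨hne, hm⟩, hk₃⟩, hk₄⟩, hx.2⟩
  obtain ⟨e, he⟩ := exists_surjective_nat (ℕ × ℕ × ℕ × ℕ)
  calc μ (jumpSet n f ∩ Ω) ≤ μ (jumpSet n f ∩ Ω ∩ {x | ‖σ x‖ = 1}) := by
        refine measure_mono_ae ?_
        filter_upwards [hp.2.2.2.1] with x hx hxJ
        exact ⟨hxJ, hx⟩
    _ ≤ μ (⋃ k, P (e k)) := by
        rw [he.iUnion_comp P]
        exact measure_mono hcover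
    _ ≤ _ := measure_le_of_iUnion_isOscBounded (by linarith) hΩ (fun k => hPm _)
        (fun k => Set.inter_subset_right) fun k => hPosc _

lemma measure_jumpSet_le (i₀ : Fin n) (hΩ : IsOpen Ω)
    (hf : LocallyIntegrableOn f Ω) (hp : IsVariationPair n f Ω μ σ) :
    μ (jumpSet n f ∩ Ω) ≤ 2 * liminf (fun ε => kappa n ε f Ω) (𝓝[>] (0 : ℝ)) := by
  set M := liminf (fun ε => kappa n ε f Ω) (𝓝[>] (0 : ℝ))
  by_cases hM : M = ⊤
  · rw [hM, ENNReal.mul_top two_ne_zero]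
    exact le_top
  have hlim : Tendsto (fun C => ENNReal.ofReal C * M) (𝓝[>] (2 : ℝ)) (𝓝 (ENNReal.ofReal 2 * M)) :=
    ENNReal.Tendsto.mul_const
      ((ENNReal.continuous_ofReal.tendsto 2).mono_left nhdsWithin_le_nhds) (Or.inr hM)
  rw [ENNReal.ofReal_ofNat] at hlim
  refine ge_of_tendsto hlim ?_
  filter_upwards [self_mem_nhdsWithin] with C hC
  exact measure_jumpSet_le_of_two_lt i₀ hC hΩ hf hp

end Covering

section WeakLimit

variable {n : ℕ}

/-- A sequence of measures of uniformly bounded mass has a vague limit of bounded mass along every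
ultrafilter. -/
lemma exists_vague_limit (U : Ultrafilter ℕ) (μ : ℕ → Measure (EuclideanSpace ℝ (Fin n)))
    [∀ k, IsFiniteMeasure (μ k)] {C : ℝ} (hμ : ∀ k, (μ k).real Set.univ ≤ C) :
    ∃ ν : Measure (EuclideanSpace ℝ (Fin n)), IsFiniteMeasure ν ∧
      ∀ g : EuclideanSpace ℝ (Fin n) → ℝ, Continuous g → HasCompactSupport g →
        Tendsto (fun k => ∫ x, g x ∂μ k) U (𝓝 (∫ x, g x ∂ν)) := by
  have hInt (k) (g : CompactlySupportedContinuousMap (EuclideanSpace ℝ (Fin n)) ℝ) :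
      Integrable (fun x => g x) (μ k) :=
    g.continuous.integrable_of_hasCompactSupport g.hasCompactSupport
  have L (g : CompactlySupportedContinuousMap (EuclideanSpace ℝ (Fin n)) ℝ) :
      ∃ y : ℝ, Tendsto (fun k => ∫ x, g x ∂μ k) U (𝓝 y) := by
    obtain ⟨B, hB⟩ := g.hasCompactSupport.exists_bound_of_continuous g.continuous
    have hB0 : 0 ≤ B := (norm_nonneg _).trans (hB 0)
    obtain ⟨y, -, hy⟩ := (isCompact_closedBall (0 : ℝ) (B * C)).ultrafilter_le_nhds'
      (U.map fun k => ∫ x, g x ∂μ k) (by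
        refine Ultrafilter.mem_map.2 (Filter.univ_mem' fun k => ?_)
        rw [Set.mem_preimage, mem_closedBall_zero_iff]
        exact (norm_integral_le_of_norm_le_const (Filter.Eventually.of_forall hB)).trans
          (by gcongr; exact hμ k))
    exact ⟨y, hy⟩
  choose Λ hΛ using L
  let Λ' : CompactlySupportedContinuousMap (EuclideanSpace ℝ (Fin n)) ℝ →ₚ[ℝ] ℝ :=
  { toFun := Λ
    map_add' g g' := by
      refine tendsto_nhds_unique (hΛ (g + g')) (((hΛ g).add (hΛ g')).congr fun k => ?_)
      exact (integral_add (hInt k g) (hInt k g')).symm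
    map_smul' c g := by
      refine tendsto_nhds_unique (hΛ (c • g)) (((hΛ g).const_smul c).congr fun k => ?_)
      exact (integral_smul c _).symm
    monotone' g g' hgg' := le_of_tendsto_of_tendsto' (hΛ g) (hΛ g') fun k =>
      integral_mono (hInt k g) (hInt k g') hgg' }
  have hK (K : Set (EuclideanSpace ℝ (Fin n))) (hK : IsCompact K) :
      RealRMK.rieszMeasure Λ' K ≤ ENNReal.ofReal C := by
    obtain ⟨g, hg1, -, hgc, hg⟩ := exists_continuous_one_zero_of_isCompact hK isClosed_empty
      (Set.disjoint_empty K)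
    let g' : CompactlySupportedContinuousMap (EuclideanSpace ℝ (Fin n)) ℝ := ⟨g, hgc⟩
    refine (RealRMK.rieszMeasure_le_of_eq_one Λ' (f := g') (fun x => (hg x).1) hK hg1).trans ?_
    refine ENNReal.ofReal_le_ofReal (le_of_tendsto (hΛ g') (Filter.Eventually.of_forall fun k => ?_))
    calc ∫ x, g x ∂μ k ≤ ∫ _x, (1 : ℝ) ∂μ k :=
          integral_mono (hInt k g') (integrable_const 1) fun x => (hg x).2
      _ ≤ C := by simpa using hμ k
  refine ⟨RealRMK.rieszMeasure Λ', ⟨?_⟩, fun g hg hgc => ?_⟩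
  · rw [← iUnion_closedBall_nat (0 : EuclideanSpace ℝ (Fin n)),
      (directed_of_isDirected_le fun i j hij =>
        closedBall_subset_closedBall (by exact_mod_cast hij)).measure_iUnion]
    exact (iSup_le fun k => hK _ (isCompact_closedBall _ _)).trans_lt ENNReal.ofReal_lt_top
  · have := RealRMK.integral_rieszMeasure Λ' ⟨⟨g, hg⟩, hgc⟩
    have h2 := hΛ ⟨⟨g, hg⟩, hgc⟩
    simp only [CompactlySupportedContinuousMap.coe_mk, ContinuousMap.coe_mk] at this h2
    rw [this]
    exact h2

lemma exists_vague_limit_sub (U : Ultrafilter ℕ) (g : ℕ → EuclideanSpace ℝ (Fin n) → ℝ)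
    (hg : ∀ k, Integrable (g k)) {C : ℝ} (hC : ∀ k, ∫ x, |g k x| ≤ C) :
    ∃ ν₁ ν₂ : Measure (EuclideanSpace ℝ (Fin n)), IsFiniteMeasure ν₁ ∧ IsFiniteMeasure ν₂ ∧
      ∀ φ : EuclideanSpace ℝ (Fin n) → ℝ, Continuous φ → HasCompactSupport φ →
        Tendsto (fun k => ∫ x, φ x * g k x) U (𝓝 (∫ x, φ x ∂ν₁ - ∫ x, φ x ∂ν₂)) := by
  have key (g : ℕ → EuclideanSpace ℝ (Fin n) → ℝ) (hg : ∀ k, Integrable (g k))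
      (hC : ∀ k, ∫ x, |g k x| ≤ C) :
      ∃ ν : Measure (EuclideanSpace ℝ (Fin n)), IsFiniteMeasure ν ∧
        ∀ φ : EuclideanSpace ℝ (Fin n) → ℝ, Continuous φ → HasCompactSupport φ →
          Tendsto (fun k => ∫ x, φ x * max (g k x) 0) U (𝓝 (∫ x, φ x ∂ν)) := by
    have hfin (k) : IsFiniteMeasure (volume.withDensity fun x => ENNReal.ofReal (g k x)) :=
      isFiniteMeasure_withDensity_ofReal (hg k).2
    obtain ⟨ν, hν, h⟩ := exists_vague_limit U
      (fun k => volume.withDensity fun x => ENNReal.ofReal (g k x)) (C := C) fun k => by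
        rw [measureReal_def, withDensity_apply _ MeasurableSet.univ, Measure.restrict_univ]
        refine ENNReal.toReal_le_of_le_ofReal ((integral_nonneg fun x => abs_nonneg _).trans (hC k))
          (le_trans ?_ (ENNReal.ofReal_le_ofReal (hC k)))
        rw [ofReal_integral_eq_lintegral_ofReal (hg k).abs
          (Filter.Eventually.of_forall fun x => abs_nonneg _)]
        exact lintegral_mono fun x => ENNReal.ofReal_le_ofReal (le_abs_self _)
    refine ⟨ν, hν, fun φ hφ hφc => (h φ hφ hφc).congr fun k => ?_⟩
    rw [show (fun x => ENNReal.ofReal (g k x)) = fun x => ((g k x).toNNReal : ℝ≥0∞) from rfl,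
      integral_withDensity_eq_integral_smul₀ (hg k).1.aemeasurable.real_toNNReal]
    refine integral_congr_ae (Filter.Eventually.of_forall fun x => ?_)
    simp only [NNReal.smul_def, Real.coe_toNNReal', smul_eq_mul, mul_comm]
  obtain ⟨ν₁, h₁, hν₁⟩ := key g hg hC
  obtain ⟨ν₂, h₂, hν₂⟩ := key (fun k x => -g k x) (fun k => (hg k).neg) (by simpa using hC)
  refine ⟨ν₁, ν₂, h₁, h₂, fun φ hφ hφc => ((hν₁ φ hφ hφc).sub (hν₂ φ hφ hφc)).congr fun k => ?_⟩
  obtain ⟨B, hB⟩ := hφc.exists_bound_of_continuous hφ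
  have hi (u : EuclideanSpace ℝ (Fin n) → ℝ) (hu : Integrable u) :
      Integrable fun x => φ x * max (u x) 0 :=
    hu.pos_part.bdd_mul hφ.aestronglyMeasurable (Filter.Eventually.of_forall hB)
  rw [← integral_sub (hi (g k) (hg k)) (hi (fun x => -g k x) (hg k).neg)]
  refine integral_congr_ae (Filter.Eventually.of_forall fun x => ?_)
  simp only [← mul_sub]
  congr 1
  rcases le_total 0 (g k x) with h | h <;> simp [h]

end WeakLimit

section Polar

variable {n : ℕ}

lemma exists_polar_decomposition {Ω : Set (EuclideanSpace ℝ (Fin n))} (hΩ : IsOpen Ω)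
    (ν₁ ν₂ : Fin n → Measure (EuclideanSpace ℝ (Fin n)))
    [h₁ : ∀ i, IsFiniteMeasure (ν₁ i)] [h₂ : ∀ i, IsFiniteMeasure (ν₂ i)] :
    ∃ (μ : Measure (EuclideanSpace ℝ (Fin n)))
      (σ : EuclideanSpace ℝ (Fin n) → EuclideanSpace ℝ (Fin n)),
      IsFiniteMeasure μ ∧ μ Ωᶜ = 0 ∧ AEStronglyMeasurable σ μ ∧ (∀ᵐ x ∂μ, ‖σ x‖ = 1) ∧
      ∀ Φ : EuclideanSpace ℝ (Fin n) → EuclideanSpace ℝ (Fin n),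
        Continuous Φ → HasCompactSupport Φ → tsupport Φ ⊆ Ω →
        ∑ i, (∫ x, Φ x i ∂ν₁ i - ∫ x, Φ x i ∂ν₂ i) = ∫ x, ⟪Φ x, σ x⟫ ∂μ := by
  let ρ : Measure (EuclideanSpace ℝ (Fin n)) := ∑ i, ((ν₁ i).restrict Ω + (ν₂ i).restrict Ω)
  have hρ₁ (i) : (ν₁ i).restrict Ω ≤ ρ :=
    le_trans (Measure.le_add_right le_rfl)
      (Finset.single_le_sum (f := fun i => (ν₁ i).restrict Ω + (ν₂ i).restrict Ω)
        (fun _ _ => Measure.zero_le _) (Finset.mem_univ i))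
  have hρ₂ (i) : (ν₂ i).restrict Ω ≤ ρ :=
    le_trans (Measure.le_add_left le_rfl)
      (Finset.single_le_sum (f := fun i => (ν₁ i).restrict Ω + (ν₂ i).restrict Ω)
        (fun _ _ => Measure.zero_le _) (Finset.mem_univ i))
  have hρf : IsFiniteMeasure ρ := by
    refine ⟨?_⟩
    simp only [ρ, Measure.coe_finsetSum, Finset.sum_apply, ENNReal.sum_lt_top]
    exact fun i _ => measure_lt_top _ _
  have hρΩ : ρ Ωᶜ = 0 := by
    simp [ρ, Measure.restrict_apply hΩ.measurableSet.compl]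
  let d (ν : Measure (EuclideanSpace ℝ (Fin n))) (x : EuclideanSpace ℝ (Fin n)) : ℝ :=
    ((ν.restrict Ω).rnDeriv ρ x).toReal
  have hd (ν) : Measurable (d ν) := (Measure.measurable_rnDeriv _ _).ennreal_toReal
  have hdi (ν) [IsFiniteMeasure ν] : Integrable (d ν) ρ := Measure.integrable_toReal_rnDeriv
  have hdφ (ν) [IsFiniteMeasure ν] (hν : ν.restrict Ω ≤ ρ) (φ : EuclideanSpace ℝ (Fin n) → ℝ)
      (hφ : ∀ x ∉ Ω, φ x = 0) : ∫ x, φ x ∂ν = ∫ x, d ν x * φ x ∂ρ := by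
    have : SigmaFinite ρ := inferInstance
    have := Measure.haveLebesgueDecomposition_of_sigmaFinite (ν.restrict Ω) ρ
    rw [← setIntegral_eq_integral_of_forall_compl_eq_zero hφ,
      ← integral_rnDeriv_smul (Measure.absolutelyContinuous_of_le hν)]
    rfl
  let h (x : EuclideanSpace ℝ (Fin n)) : EuclideanSpace ℝ (Fin n) :=
    WithLp.toLp 2 fun i => d (ν₁ i) x - d (ν₂ i) x
  have hh : Measurable h :=
    (WithLp.measurable_toLp 2 _).comp (measurable_pi_lambda _ fun i => (hd _).sub (hd _))
  have hhi : Integrable h ρ := by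
    have : h = fun x => ∑ i, (d (ν₁ i) x - d (ν₂ i) x) • EuclideanSpace.single i (1 : ℝ) := by
      ext x j
      simp [h, Finset.sum_apply, Pi.single_apply]
    rw [this]
    exact integrable_finsetSum _ fun i _ => ((hdi _).sub (hdi _)).smul_const _
  refine ⟨ρ.withDensity fun x => (‖h x‖₊ : ℝ≥0∞), fun x => ‖h x‖⁻¹ • h x, ?_, ?_, ?_, ?_, ?_⟩
  · exact isFiniteMeasure_withDensity (hhi.2.ne)
  · exact withDensity_absolutelyContinuous _ _ hρΩ
  · exact (hh.norm.inv.smul hh).aestronglyMeasurable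
  · rw [ae_withDensity_iff hh.nnnorm.coe_nnreal_ennreal]
    refine Filter.Eventually.of_forall fun x hx => ?_
    have : ‖h x‖ ≠ 0 := by simpa using hx
    rw [norm_smul, norm_inv, norm_norm, inv_mul_cancel₀ this]
  · intro Φ hΦ hΦc hΦΩ
    have h0 (i) (x) (hx : x ∉ Ω) : Φ x i = 0 := by
      rw [image_eq_zero_of_notMem_tsupport fun hx' => hx (hΦΩ hx')]
      rfl
    obtain ⟨B, hB⟩ := hΦc.exists_bound_of_continuous hΦ
    have hmul (ν) [IsFiniteMeasure ν] (i) : Integrable (fun x => d ν x * Φ x i) ρ :=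
      (hdi ν).mul_bdd (by fun_prop) (Filter.Eventually.of_forall fun x =>
        (abs_coord_le_norm _ i).trans (hB x))
    rw [integral_withDensity_eq_integral_smul hh.nnnorm]
    calc ∑ i, (∫ x, Φ x i ∂ν₁ i - ∫ x, Φ x i ∂ν₂ i)
        = ∑ i, ∫ x, (d (ν₁ i) x - d (ν₂ i) x) * Φ x i ∂ρ := by
          refine Finset.sum_congr rfl fun i _ => ?_
          rw [hdφ _ (hρ₁ i) _ (h0 i), hdφ _ (hρ₂ i) _ (h0 i), ← integral_sub (hmul _ i) (hmul _ i)]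
          simp only [sub_mul]
      _ = ∫ x, ∑ i, (d (ν₁ i) x - d (ν₂ i) x) * Φ x i ∂ρ := by
          rw [integral_finsetSum]
          intro i _
          simp only [sub_mul]
          exact (hmul _ i).sub (hmul _ i)
      _ = _ := by
          refine integral_congr_ae (Filter.Eventually.of_forall fun x => ?_)
          have : ∑ i, (d (ν₁ i) x - d (ν₂ i) x) * Φ x i = ⟪Φ x, h x⟫ := by
            simp [PiLp.inner_apply, h]
          simp only [this, NNReal.smul_def, coe_nnnorm, inner_smul_right, smul_eq_mul]
          by_cases hx : ‖h x‖ = 0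
          · rw [norm_eq_zero] at hx
            simp [hx]
          · rw [mul_inv_cancel_left₀ hx]

end Polar

section DifferenceQuotient

variable {n : ℕ}

/-- Discrete integration by parts for difference quotients, in the limit of vanishing step. -/
lemma tendsto_integral_mul_differenceQuotient {Ω : Set (EuclideanSpace ℝ (Fin n))} (hΩ : IsOpen Ω)
    {f : EuclideanSpace ℝ (Fin n) → ℝ} (hf : LocallyIntegrableOn f Ω volume)
    {φ : EuclideanSpace ℝ (Fin n) → ℝ} (hφ : ContDiff ℝ 1 φ) (hφc : HasCompactSupport φ)
    (hφΩ : tsupport φ ⊆ Ω) (e : EuclideanSpace ℝ (Fin n)) {t : ℕ → ℝ}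
    (ht : Tendsto t atTop (𝓝[>] 0)) {A : ℕ → Set (EuclideanSpace ℝ (Fin n))}
    (hA : ∀ K ⊆ Ω, IsCompact K → ∀ᶠ k in atTop, K ⊆ A k) :
    Tendsto (fun k => ∫ x, φ x * (A k).indicator (fun x => (f (x - t k • e) - f x) / t k) x) atTop
      (𝓝 (∫ x in Ω, f x * fderiv ℝ φ x e)) := by
  obtain ⟨δ, hδ, hδΩ⟩ := hφc.isCompact.exists_cthickening_subset_open hΩ hφΩ
  let F := (cthickening δ (tsupport φ)).indicator f
  have hK' : IsCompact (cthickening δ (tsupport φ)) := hφc.isCompact.cthickening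
  have hF : Integrable F :=
    (integrable_indicator_iff isClosed_cthickening.measurableSet).2
      (hf.integrableOn_compact_subset hδΩ hK')
  have hFeq (x) (hx : x ∈ cthickening δ (tsupport φ)) : F x = f x := Set.indicator_of_mem hx f
  have ht0 : Tendsto t atTop (𝓝 0) := ht.mono_right nhdsWithin_le_nhds
  have htpos : ∀ᶠ k in atTop, 0 < t k := ht.eventually self_mem_nhdsWithin
  have htδ : ∀ᶠ k in atTop, ‖t k • e‖ ≤ δ := by
    have : Tendsto (fun k => ‖t k • e‖) atTop (𝓝 0) := by
      simpa using (ht0.smul_const e).norm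
    exact (this.eventually_lt_const hδ).mono fun k hk => hk.le
  have hφ' : Continuous φ := hφ.continuous
  obtain ⟨B, hB⟩ := hφc.exists_bound_of_continuous hφ'
  have heq : ∀ᶠ k in atTop, ∫ x, F x * ((t k)⁻¹ • (φ (x + t k • e) - φ x)) =
      ∫ x, φ x * (A k).indicator (fun x => (f (x - t k • e) - f x) / t k) x := by
    filter_upwards [htδ, hA _ hφΩ hφc] with k hk hAk
    have h1 : Integrable fun x => F x * φ (x + t k • e) :=
      hF.mul_bdd (by fun_prop) (Filter.Eventually.of_forall fun x => hB _)
    have h2 : Integrable fun x => F x * φ x :=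
      hF.mul_bdd (by fun_prop) (Filter.Eventually.of_forall fun x => hB _)
    have h3 : Integrable fun x => F (x - t k • e) * φ x :=
      (hF.comp_sub_right (t k • e)).mul_bdd (by fun_prop)
        (Filter.Eventually.of_forall fun x => hB _)
    calc ∫ x, F x * ((t k)⁻¹ • (φ (x + t k • e) - φ x))
        = (t k)⁻¹ * ((∫ x, F x * φ (x + t k • e)) - ∫ x, F x * φ x) := by
          rw [← integral_sub h1 h2, ← integral_const_mul]
          congr 1 with x
          rw [smul_eq_mul]
          ring
      _ = (t k)⁻¹ * ((∫ x, F (x - t k • e) * φ x) - ∫ x, F x * φ x) := by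
          rw [← integral_sub_right_eq_self _ (t k • e)]
          simp only [sub_add_cancel]
      _ = _ := by
          rw [← integral_sub h3 h2, ← integral_const_mul]
          congr 1 with x
          by_cases hx : x ∈ tsupport φ
          · rw [Set.indicator_of_mem (hAk hx), hFeq x (self_subset_cthickening _ hx),
              hFeq (x - t k • e) (mem_cthickening_of_dist_le _ x _ _ hx (by simpa using hk))]
            ring
          · rw [image_eq_zero_of_notMem_tsupport hx]
            simp
  obtain ⟨L, hL⟩ := hφ.lipschitzWith_of_hasCompactSupport hφc one_ne_zero
  have hlim : Tendsto (fun k => ∫ x, F x * ((t k)⁻¹ • (φ (x + t k • e) - φ x))) atTop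
      (𝓝 (∫ x, F x * fderiv ℝ φ x e)) := by
    refine tendsto_integral_filter_of_dominated_convergence (fun x => ‖F x‖ * (L * ‖e‖)) ?_ ?_ ?_ ?_
    · exact Filter.Eventually.of_forall fun k => hF.1.mul (by fun_prop)
    · filter_upwards [htpos] with k hk
      refine Filter.Eventually.of_forall fun x => ?_
      rw [norm_mul]
      gcongr
      rw [norm_smul, norm_inv, inv_mul_le_iff₀ (norm_pos_iff.2 hk.ne')]
      have := hL.norm_sub_le (x + t k • e) x
      rw [add_sub_cancel_left, norm_smul] at this
      linarith
    · exact hF.norm.mul_const _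
    · refine Filter.Eventually.of_forall fun x => Tendsto.const_mul _ ?_
      have hd : HasFDerivAt φ (fderiv ℝ φ x) x :=
        (hφ.differentiable one_ne_zero x).hasFDerivAt
      exact (hd.hasLineDerivAt e).tendsto_slope_zero_right.comp ht
  convert hlim.congr' heq using 2
  rw [← integral_indicator hΩ.measurableSet]
  congr 1 with x
  by_cases hx : x ∈ tsupport φ
  · rw [Set.indicator_of_mem (hφΩ hx), hFeq x (self_subset_cthickening _ hx)]
  · have : fderiv ℝ φ x = 0 :=
      image_eq_zero_of_notMem_tsupport fun h => hx (tsupport_fderiv_subset ℝ h)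
    simp [this, Set.indicator_apply]

end DifferenceQuotient

section HalfCubes

variable {n : ℕ}

lemma mem_orientedCube_refl {x c : EuclideanSpace ℝ (Fin n)} {ε : ℝ} :
    x ∈ orientedCube (.refl ℝ _) c ε ↔ ∀ j, |x j - c j| < ε / 2 :=
  Iff.rfl

lemma lintegral_sub_translate_half_le {ε : ℝ} (hε : 0 < ε) {f : EuclideanSpace ℝ (Fin n) → ℝ}
    (c : EuclideanSpace ℝ (Fin n)) (i : Fin n)
    (hf : IntegrableOn f (orientedCube (.refl ℝ _) c ε)) :
    ∫⁻ x in orientedCube (.refl ℝ _) c ε ∩ {x | 0 < (x - c) i},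
      ‖f (x - (ε / 2) • EuclideanSpace.single i 1) - f x‖ₑ ≤
      ENNReal.ofReal (ε ^ n * meanOsc f (orientedCube (.refl ℝ _) c ε)) := by
  rw [pow_mul_meanOsc _ _ hε.le]
  set Q := orientedCube (.refl ℝ (EuclideanSpace ℝ (Fin n))) c ε with hQ
  set m := ⨍ y in Q, f y
  set H := Q ∩ {x | 0 < (x - c) i}
  set L := Q ∩ {x | (x - c) i < 0}
  have hQm : MeasurableSet Q := (isOpen_orientedCube _ c ε).measurableSet
  have hHm : MeasurableSet H := hQm.inter (measurableSet_lt (by fun_prop) (by fun_prop))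
  have hLm : MeasurableSet L := hQm.inter (measurableSet_lt (by fun_prop) (by fun_prop))
  have hvQ : volume Q ≠ ⊤ := by
    rw [volume_orientedCube _ _ hε.le]
    exact ENNReal.ofReal_ne_top
  have hi : IntegrableOn (fun x => f x - m) Q := hf.sub (integrableOn_const hvQ)
  have hHL : Disjoint L H := by
    rw [Set.disjoint_left]
    intro x hx hx'
    exact lt_asymm (a := (x - c) i) hx.2 hx'.2
  have hshift : ∀ x ∈ H, x - (ε / 2) • EuclideanSpace.single i 1 ∈ L := by
    intro x hx
    have hco (j) : (x - (ε / 2) • EuclideanSpace.single i 1 : EuclideanSpace ℝ (Fin n)) j =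
        x j - if j = i then ε / 2 else 0 := by
      simp
    have hxi := abs_lt.1 (mem_orientedCube_refl.1 hx.1 i)
    have hx0 : 0 < x i - c i := hx.2
    refine ⟨mem_orientedCube_refl.2 fun j => ?_, ?_⟩
    · rw [hco]
      split_ifs with hj
      · subst hj
        rw [abs_lt]
        constructor <;> linarith
      · simpa using mem_orientedCube_refl.1 hx.1 j
    · rw [Set.mem_ofPred_eq, PiLp.sub_apply, hco, if_pos rfl]
      linarith
  calc ∫⁻ x in H, ‖f (x - (ε / 2) • EuclideanSpace.single i 1) - f x‖ₑ
      ≤ ∫⁻ x in H, (‖f (x - (ε / 2) • EuclideanSpace.single i 1) - m‖ₑ + ‖f x - m‖ₑ) := by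
        refine lintegral_mono fun x => ?_
        rw [← sub_sub_sub_cancel_right _ _ m]
        exact enorm_sub_le
    _ = (∫⁻ x in H, ‖f (x - (ε / 2) • EuclideanSpace.single i 1) - m‖ₑ) +
          ∫⁻ x in H, ‖f x - m‖ₑ :=
        lintegral_add_right' _ (hi.mono_set Set.inter_subset_left).1.enorm
    _ ≤ (∫⁻ x in L, ‖f x - m‖ₑ) + ∫⁻ x in H, ‖f x - m‖ₑ := by
        gcongr ?_ + _
        rw [← lintegral_indicator hHm, ← lintegral_indicator hLm,
          
          ← lintegral_sub_right_eq_self (L.indicator fun x => ‖f x - m‖ₑ)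
            ((ε / 2) • EuclideanSpace.single i (1 : ℝ))]
        refine lintegral_mono fun x => ?_
        by_cases hx : x ∈ H
        · rw [Set.indicator_of_mem hx, Set.indicator_of_mem (hshift x hx)]
        · rw [Set.indicator_of_notMem hx]
          exact zero_le
    _ = ∫⁻ x in L ∪ H, ‖f x - m‖ₑ := (lintegral_union hHm hHL).symm
    _ ≤ ∫⁻ x in Q, ‖f x - m‖ₑ :=
        lintegral_mono_set (Set.union_subset Set.inter_subset_left Set.inter_subset_left)
    _ = ENNReal.ofReal (∫ x in Q, |f x - m|) := (ofReal_integral_norm_eq_lintegral_enorm hi).symm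

/-- The grid points `ε ℤⁿ`, translated by `ε / 2` in direction `i` if `s = 1`. -/
def gridPoint (ε : ℝ) (i : Fin n) (s : Fin 2) (z : Fin n → ℤ) : EuclideanSpace ℝ (Fin n) :=
  WithLp.toLp 2 fun j => ε * z j + if j = i then (s : ℕ) * (ε / 2) else 0

lemma ae_exists_mem_half_orientedCube {ε : ℝ} (hε : 0 < ε) (i : Fin n) :
    ∀ᵐ x : EuclideanSpace ℝ (Fin n), ∃ s z,
      x ∈ orientedCube (.refl ℝ _) (gridPoint ε i s z) ε ∩ {x | 0 < (x - gridPoint ε i s z) i} := by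
  have hnull : ∀ᵐ x : EuclideanSpace ℝ (Fin n), ∀ j, ∀ m : ℤ, x j ≠ ε * m / 2 := by
    refine ae_all_iff.2 fun j => ae_all_iff.2 fun m => ?_
    have := volume_coord_eq (.refl ℝ (EuclideanSpace ℝ (Fin n))) 0 j (ε * m / 2)
    simp only [sub_zero] at this
    rw [ae_iff]
    simp only [not_not]
    exact this
  filter_upwards [hnull] with x hx
  set z₀ : Fin n → ℤ := fun j => ⌊x j / ε + 1 / 2⌋
  have hz₀ (j) : |x j - ε * z₀ j| < ε / 2 := by
    have h1 := Int.floor_le (x j / ε + 1 / 2)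
    have h2 := Int.lt_floor_add_one (x j / ε + 1 / 2)
    have h3 := hx j (2 * z₀ j - 1)
    have h4 : x j = ε * (x j / ε) := by field_simp
    push_cast at h3
    have h5 : ε * z₀ j ≤ ε * (x j / ε + 1 / 2) := by gcongr
    have h6 : ε * (x j / ε + 1 / 2) < ε * (z₀ j + 1) := by gcongr
    have h7 : ε * (2 * z₀ j - 1) / 2 < x j := lt_of_le_of_ne (by linarith) h3.symm
    rw [abs_lt]
    constructor <;> linarith
  set m : ℤ := ⌊2 * x i / ε⌋
  have hm : ε * m / 2 < x i ∧ x i < ε * m / 2 + ε / 2 := by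
    have h1 := Int.floor_le (2 * x i / ε)
    have h2 := Int.lt_floor_add_one (2 * x i / ε)
    rw [le_div_iff₀ hε] at h1
    rw [div_lt_iff₀ hε] at h2
    exact ⟨lt_of_le_of_ne (by linarith) (hx i m).symm, by linarith⟩
  obtain ⟨k, s, hks⟩ : ∃ (k : ℤ) (s : Fin 2), m = 2 * k + (s : ℕ) := by
    rcases Int.even_or_odd' m with ⟨k, hk | hk⟩
    · exact ⟨k, 0, by simpa using hk⟩
    · exact ⟨k, 1, by simpa using hk⟩
  have hmr : (m : ℝ) = 2 * k + (s : ℕ) := by exact_mod_cast hks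
  have hi : gridPoint ε i s (Function.update z₀ i k) i = ε * m / 2 := by
    simp only [gridPoint, Function.update_self, if_true, hmr]
    ring
  refine ⟨s, Function.update z₀ i k, mem_orientedCube_refl.2 fun j => ?_, ?_⟩
  · by_cases hj : j = i
    · subst hj
      rw [hi, abs_lt]
      constructor <;> linarith
    · simpa [gridPoint, hj] using hz₀ j
  · rw [Set.mem_ofPred_eq, PiLp.sub_apply, hi]
    linarith

lemma lintegral_sub_translate_le {ε : ℝ} (hε : 0 < ε) {Ω : Set (EuclideanSpace ℝ (Fin n))}
    {f : EuclideanSpace ℝ (Fin n) → ℝ} (hf : LocallyIntegrableOn f Ω volume) (i : Fin n) :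
    ∫⁻ x in (cthickening (n * ε) Ωᶜ)ᶜ,
      ‖f (x - (ε / 2) • EuclideanSpace.single i 1) - f x‖ₑ ≤
      2 * (ENNReal.ofReal ε * kappa n ε f Ω) := by
  set A := (cthickening (n * ε) Ωᶜ)ᶜ
  have hAΩ (x) (hx : x ∈ A) : closedBall x (n * ε) ⊆ Ω := by
    intro y hy
    by_contra hyΩ
    exact hx (mem_cthickening_of_dist_le x y _ _ hyΩ (by rwa [dist_comm]))
  let Q (s : Fin 2) (z : Fin n → ℤ) : Set (EuclideanSpace ℝ (Fin n)) :=
    orientedCube (.refl ℝ _) (gridPoint ε i s z) ε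
  let H (s : Fin 2) (z : Fin n → ℤ) : Set (EuclideanSpace ℝ (Fin n)) :=
    Q s z ∩ {x | 0 < (x - gridPoint ε i s z) i}
  have hQball (s z x) (hx : x ∈ Q s z) : Q s z ⊆ closedBall x (n * ε) := by
    intro y hy
    refine dist_le_of_abs_coord_le (.refl ℝ _) hε.le fun j => ?_
    have h1 := abs_lt.1 (mem_orientedCube_refl.1 hx j)
    have h2 := abs_lt.1 (mem_orientedCube_refl.1 hy j)
    change |y j - x j| ≤ ε
    rw [abs_le]
    constructor <;> linarith
  have hsum (s : Fin 2) : ∫⁻ x in ⋃ z : {z // (Q s z ∩ A).Nonempty}, H s z,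
      ‖f (x - (ε / 2) • EuclideanSpace.single i 1) - f x‖ₑ ≤ ENNReal.ofReal ε * kappa n ε f Ω := by
    refine (lintegral_iUnion_le _ _).trans ?_
    have hball (z : {z // (Q s z ∩ A).Nonempty}) :
        ∃ x, Q s z ⊆ closedBall x (n * ε) ∧ closedBall x (n * ε) ⊆ Ω := by
      obtain ⟨x, hxQ, hxA⟩ := z.2
      exact ⟨x, hQball s z x hxQ, hAΩ x hxA⟩
    refine le_trans ?_ (mul_le_mul_right (tsum_meanOsc_le_kappa hε
      (fun z : {z // (Q s z ∩ A).Nonempty} => Q s z) (fun z => isCube_orientedCube _ _ _)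
      (fun z => ?_) fun z w hzw => ?_) _)
    · rw [← ENNReal.tsum_mul_left]
      refine ENNReal.tsum_le_tsum fun z => ?_
      obtain ⟨x, hQx, hxΩ⟩ := hball z
      refine (lintegral_sub_translate_half_le hε _ i
        ((hf.integrableOn_compact_subset hxΩ (isCompact_closedBall _ _)).mono_set hQx)).trans ?_
      have hn : n = n - 1 + 1 := by have := i.2; omega
      rw [← ENNReal.ofReal_mul (by positivity), ← ENNReal.ofReal_mul hε.le, ← mul_assoc,
        ← pow_succ', ← hn]
    · obtain ⟨x, hQx, hxΩ⟩ := hball z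
      exact hQx.trans hxΩ
    · obtain ⟨j, hj⟩ := Function.ne_iff.1 (Subtype.coe_injective.ne hzw)
      refine disjoint_orientedCube (i := j) ?_
      change ε ≤ |gridPoint ε i s z j - gridPoint ε i s w j|
      simp only [gridPoint, add_sub_add_right_eq_sub, ← mul_sub, abs_mul, abs_of_pos hε]
      refine le_mul_of_one_le_right hε.le ?_
      exact_mod_cast Int.one_le_abs (sub_ne_zero.2 hj)
  calc ∫⁻ x in A, ‖f (x - (ε / 2) • EuclideanSpace.single i 1) - f x‖ₑ
      ≤ ∫⁻ x in ⋃ s, ⋃ z : {z // (Q s z ∩ A).Nonempty}, H s z,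
          ‖f (x - (ε / 2) • EuclideanSpace.single i 1) - f x‖ₑ := by
        refine lintegral_mono_set' ?_
        filter_upwards [ae_exists_mem_half_orientedCube hε i] with x hx hxA
        obtain ⟨s, z, hsz⟩ := hx
        exact Set.mem_iUnion₂.2 ⟨s, ⟨z, x, hsz.1, hxA⟩, hsz⟩
    _ ≤ ∑ s : Fin 2, ∫⁻ x in ⋃ z : {z // (Q s z ∩ A).Nonempty}, H s z,
          ‖f (x - (ε / 2) • EuclideanSpace.single i 1) - f x‖ₑ := by
        exact (lintegral_iUnion_le _ _).trans_eq (tsum_fintype _)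
    _ ≤ ∑ _s : Fin 2, ENNReal.ofReal ε * kappa n ε f Ω := Finset.sum_le_sum fun s _ => hsum s
    _ = _ := by simp

end HalfCubes

section FiniteVariation

variable {n : ℕ}

/-- If `κ_ε(f, Ω)` stays bounded along a sequence `ε → 0`, then the distributional gradient of `f`
is a finite measure. -/
lemma exists_isVariationPair {Ω : Set (EuclideanSpace ℝ (Fin n))} (hΩ : IsOpen Ω)
    {f : EuclideanSpace ℝ (Fin n) → ℝ} (hf : LocallyIntegrableOn f Ω volume)
    (h : liminf (fun ε => kappa n ε f Ω) (𝓝[>] (0 : ℝ)) < ⊤) :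
    ∃ p : Measure (EuclideanSpace ℝ (Fin n)) ×
      (EuclideanSpace ℝ (Fin n) → EuclideanSpace ℝ (Fin n)), IsVariationPair n f Ω p.1 p.2 := by
  obtain ⟨C, hC, hCtop⟩ := exists_between h
  obtain ⟨ε, hε, hεC⟩ := exists_seq_forall_of_frequently
    ((frequently_lt_of_liminf_lt (by isBoundedDefault) hC).and_eventually
      (self_mem_nhdsWithin : Set.Ioi (0 : ℝ) ∈ 𝓝[>] 0))
  have hpos (k) : 0 < ε k := (hεC k).2
  have hε0 : Tendsto ε atTop (𝓝 0) := hε.mono_right nhdsWithin_le_nhds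
  have ht : Tendsto (fun k => ε k / 2) atTop (𝓝[>] 0) :=
    tendsto_nhdsWithin_iff.2 ⟨by simpa using hε0.div_const 2,
      Filter.Eventually.of_forall fun k => half_pos (hpos k)⟩
  let A (k : ℕ) : Set (EuclideanSpace ℝ (Fin n)) := (cthickening (n * ε k) Ωᶜ)ᶜ
  have hAm (k) : MeasurableSet (A k) := isClosed_cthickening.measurableSet.compl
  have hAK : ∀ K ⊆ Ω, IsCompact K → ∀ᶠ k in atTop, K ⊆ A k := by
    intro K hKΩ hK
    obtain ⟨δ, hδ, hdisj⟩ := (Set.disjoint_compl_right_iff_subset.2 hKΩ).exists_cthickenings hK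
      hΩ.isClosed_compl
    have : Tendsto (fun k => n * ε k) atTop (𝓝 0) := by simpa using hε0.const_mul (n : ℝ)
    filter_upwards [this.eventually_lt_const hδ] with k hk x hxK hx
    exact hdisj.le_bot ⟨self_subset_cthickening _ hxK, cthickening_mono hk.le _ hx⟩
  let g (i : Fin n) (k : ℕ) : EuclideanSpace ℝ (Fin n) → ℝ :=
    (A k).indicator fun x => (f (x - (ε k / 2) • EuclideanSpace.single i 1) - f x) / (ε k / 2)
  have hgl (i k) : ∫⁻ x, ‖g i k x‖ₑ ≤ 4 * C := by
    have h2 : (ENNReal.ofReal (ε k)) ≠ 0 := by simpa using hpos k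
    calc ∫⁻ x, ‖g i k x‖ₑ
        = ∫⁻ x in A k, ENNReal.ofReal (2 / ε k) *
            ‖f (x - (ε k / 2) • EuclideanSpace.single i 1) - f x‖ₑ := by
          rw [← lintegral_indicator (hAm k)]
          congr 1 with x
          simp only [g, enorm_indicator_eq_indicator_enorm]
          congr 1 with y
          rw [div_eq_inv_mul, enorm_mul, inv_div, Real.enorm_of_nonneg (by have := hpos k; positivity)]
      _ = ENNReal.ofReal (2 / ε k) * ∫⁻ x in A k,
            ‖f (x - (ε k / 2) • EuclideanSpace.single i 1) - f x‖ₑ :=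
          lintegral_const_mul' _ _ ENNReal.ofReal_ne_top
      _ ≤ ENNReal.ofReal (2 / ε k) * (2 * (ENNReal.ofReal (ε k) * C)) := by
          gcongr
          refine (lintegral_sub_translate_le (hpos k) hf i).trans ?_
          gcongr
          exact (hεC k).1.le
      _ = 4 * C := by
          rw [← mul_assoc, ← mul_assoc, mul_right_comm _ 2, ← ENNReal.ofReal_mul
            (by have := hpos k; positivity), div_mul_cancel₀ _ (hpos k).ne']
          norm_num
  have hgi (i k) : Integrable (g i k) := by
    refine ⟨?_, (hgl i k).trans_lt (ENNReal.mul_lt_top (by simp) hCtop)⟩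
    have hF : AEStronglyMeasurable (Ω.indicator f) volume :=
      (aestronglyMeasurable_indicator_iff hΩ.measurableSet).2 hf.aestronglyMeasurable
    have heq : g i k = (A k).indicator fun x => (Ω.indicator f
        (x - (ε k / 2) • EuclideanSpace.single i 1) - Ω.indicator f x) / (ε k / 2) := by
      refine Set.indicator_congr fun x hx => ?_
      have hmem (y) (hy : dist x y ≤ n * ε k) : y ∈ Ω := by
        by_contra hyΩ
        exact hx (mem_cthickening_of_dist_le x y _ _ hyΩ hy)
      have hn : (1 : ℝ) ≤ n := by exact_mod_cast i.pos
      rw [Set.indicator_of_mem (hmem _ ?_), Set.indicator_of_mem (hmem x ?_)]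
      · rw [dist_self]
        have := hpos k
        positivity
      · rw [dist_self_sub_right, norm_smul, PiLp.norm_single, norm_one, mul_one,
          Real.norm_of_nonneg (half_pos (hpos k)).le]
        nlinarith [hpos k]
    rw [heq]
    simp only [div_eq_mul_inv]
    exact (((hF.comp_measurePreserving (measurePreserving_sub_right volume _)).sub hF).mul_const
      _).indicator (hAm k)
  have hgC (i k) : ∫ x, |g i k x| ≤ (4 * C).toReal := by
    have := integral_norm_eq_lintegral_enorm (hgi i k).1
    simp only [Real.norm_eq_abs] at this
    rw [this]
    exact ENNReal.toReal_mono (ENNReal.mul_lt_top (by simp) hCtop).ne (hgl i k)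
  let U : Ultrafilter ℕ := Filter.hyperfilter ℕ
  have hU : (U : Filter ℕ) ≤ atTop := Nat.hyperfilter_le_atTop
  choose ν₁ ν₂ h₁ h₂ hν using fun i => exists_vague_limit_sub U (g i) (hgi i) (hgC i)
  obtain ⟨μ, σ, hμ, hμΩ, hσ, hσ1, hpair⟩ := exists_polar_decomposition hΩ ν₂ ν₁
  refine ⟨(μ, σ), hμ, hμΩ, hσ, hσ1, fun Φ hΦ hΦc hΦΩ => ?_⟩
  have hcd (i : Fin n) : ContDiff ℝ 1 fun x => Φ x i := (contDiff_euclidean (𝕜 := ℝ)).1 hΦ i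
  have hsupp (i : Fin n) : tsupport (fun x => Φ x i) ⊆ tsupport Φ :=
    closure_mono fun x hx (h0 : Φ x = 0) => hx (congrFun (congrArg WithLp.ofLp h0) i)
  have hc (i : Fin n) : HasCompactSupport fun x => Φ x i :=
    hΦc.of_isClosed_subset (isClosed_tsupport _) (hsupp i)
  have hi (i : Fin n) : ∫ x, Φ x i ∂ν₁ i - ∫ x, Φ x i ∂ν₂ i =
      ∫ x in Ω, f x * fderiv ℝ (fun x => Φ x i) x (EuclideanSpace.single i 1) :=
    tendsto_nhds_unique (hν i _ (hcd i).continuous (hc i))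
      ((tendsto_integral_mul_differenceQuotient hΩ hf (hcd i) (hc i) ((hsupp i).trans hΦΩ) _ ht
        hAK).mono_left hU)
  rw [← hpair Φ hΦ.continuous hΦc hΦΩ, ← Finset.sum_neg_distrib]
  simp only [neg_sub, hi]
  have hInt (i : Fin n) : IntegrableOn
      (fun x => f x * fderiv ℝ (fun x => Φ x i) x (EuclideanSpace.single i 1)) Ω := by
    refine Integrable.integrableOn ((integrableOn_iff_integrable_of_support_subset
      (s := tsupport Φ) fun x hx => ?_).1 ((hf.integrableOn_compact_subset hΦΩ hΦc).mul_continuousOn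
        (((hcd i).continuous_fderiv one_ne_zero).clm_apply continuous_const).continuousOn hΦc))
    by_contra hxΦ
    refine hx ?_
    beta_reduce
    rw [image_eq_zero_of_notMem_tsupport (f := fderiv ℝ fun x => Φ x i) fun h =>
      hxΦ (hsupp i (tsupport_fderiv_subset ℝ h))]
    simp
  rw [← integral_finsetSum _ fun i _ => hInt i]
  refine integral_congr_ae (Filter.Eventually.of_forall fun x => ?_)
  simp only [vdiv, Finset.mul_sum]
  refine Finset.sum_congr rfl fun i _ => ?_
  have hd := (hΦ.differentiable one_ne_zero x).hasFDerivAt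
  have hdi : HasFDerivAt (fun x => Φ x i) _ x :=
    (EuclideanSpace.proj (𝕜 := ℝ) i).hasFDerivAt.comp x hd
  rw [hdi.fderiv]
  rfl

end FiniteVariation

/-- `(1/2)·|D^j f|(Ω) ≤ liminf_{ε→0} κ_ε(f, Ω)`. -/
theorem half_jumpVar_le_liminf_kappa_self
    (n : ℕ) (hn : 1 ≤ n)
    (Ω : Set (EuclideanSpace ℝ (Fin n))) (hΩ : IsOpen Ω)
    (f : EuclideanSpace ℝ (Fin n) → ℝ) (hf : LocallyIntegrableOn f Ω volume) :
    jumpVar n f Ω / 2 ≤ liminf (fun ε => kappa n ε f Ω) (𝓝[>] (0:ℝ)) := by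
  have i₀ : Fin n := ⟨0, by omega⟩
  unfold jumpVar
  split_ifs with h
  · rw [ENNReal.div_le_iff_le_mul (.inl two_ne_zero) (.inl ENNReal.ofNat_ne_top), mul_comm]
    exact (Measure.singularPart_le _ _ _).trans (measure_jumpSet_le i₀ hΩ hf h.choose_spec)
  · have : liminf (fun ε => kappa n ε f Ω) (𝓝[>] (0:ℝ)) = ⊤ := by
      by_contra hlim
      exact h (exists_isVariationPair hΩ hf (lt_top_iff_ne_top.2 hlim))
    rw [this]
    exact le_top
end
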